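/- Let u be a C^∞-smooth real-valued function on the closed unit disk with u = 0 on the unit circle T. Then for every ζ in the open unit disk D, u(ζ) = ∫_D Γ₁(z,ζ)·Δ[(1−|z|²)^{−1}Δu](z) dΣ(z) + (1/2)∫_T H₁(z,ζ)·∂ₙu(z) dσ(z), where ∂ₙ denotes differentiation in the inward normal direction and dσ = |dz|/(2π) is normalized arc length measure on T. -/

import Mathlib

open Complex MeasureTheory Metric Set ComplexConjugate
noncomputable section

/-- The normalized area measure `dΣ = dx dy / π` on `ℂ`. -/
def areaM : Measure ℂ := (ENNReal.ofReal Real.pi)⁻¹ • (volume : Measure ℂ)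

/-- The Green function `G(z,ζ) = log |(z-ζ)/(1-ζ̄z)|²` for the Laplacian on the unit disk. -/
def greenG (z ζ : ℂ) : ℝ := Real.log (normSq ((z - ζ) / (1 - conj ζ * z)))

/-- The normalized Laplacian `Δ = ∂²/∂z∂z̄ = (1/4)(∂²/∂x² + ∂²/∂y²)`. -/
def lap (u : ℂ → ℝ) (z : ℂ) : ℝ :=
  (1/4) * (fderiv ℝ (fun w => fderiv ℝ u w 1) z 1
    + fderiv ℝ (fun w => fderiv ℝ u w Complex.I) z Complex.I)

/-- The harmonic compensator `H₁(z,ζ)`. -/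
def H1 (z ζ : ℂ) : ℝ :=
  (1 - normSq ζ) *
    ((1/2) * (3 - normSq ζ) * (1 - normSq (z * ζ)) / normSq (1 - z * conj ζ)
      + (1 - normSq ζ) * (z * conj ζ / (1 - z * conj ζ) ^ 2).re)

/-- The Green function `Γ₁(z,ζ)` for the weighted biharmonic operator `Δ(1-|z|²)⁻¹Δ`. -/
def Γ1 (z ζ : ℂ) : ℝ :=
  (normSq (z - ζ) - (1/4) * normSq (z ^ 2 - ζ ^ 2)) * greenG z ζ
    + (1/8) * (1 - normSq z) * (1 - normSq ζ) *
      (7 - normSq z - normSq ζ - normSq (z * ζ) - 4 * (z * conj ζ).re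
        - 2 * (1 - normSq z) * (1 - normSq ζ) * (1 - normSq (z * ζ)) / normSq (1 - z * conj ζ))

/-- Inward normal derivative at a boundary point `z` of the unit disk. -/
def dnD (u : ℂ → ℝ) (z : ℂ) : ℝ := fderivWithin ℝ u (closedBall (0:ℂ) 1) z (-z)


/-- The divergence `∂ₓP + ∂ᵧQ` of the planar field `(P, Q)`. -/
def planeDiv (P Q : ℂ → ℝ) (z : ℂ) : ℝ := fderiv ℝ P z 1 + fderiv ℝ Q z I

/-- The divergence of a planar field within the closed unit disk. -/
def planeDivWithin (P Q : ℂ → ℝ) (z : ℂ) : ℝ :=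
  fderivWithin ℝ P (closedBall 0 1) z 1 + fderivWithin ℝ Q (closedBall 0 1) z I

lemma uniqueDiffOn_closedDisk : UniqueDiffOn ℝ (closedBall (0:ℂ) 1) := by
  refine uniqueDiffOn_convex (convex_closedBall 0 1) ?_
  rw [interior_closedBall _ one_ne_zero]
  exact ⟨0, by simp⟩

lemma closedDisk_mem_nhds {z : ℂ} (hz : z ∈ ball (0:ℂ) 1) : closedBall (0:ℂ) 1 ∈ nhds z :=
  Filter.mem_of_superset (isOpen_ball.mem_nhds hz) ball_subset_closedBall

lemma planeDivWithin_eq {P Q : ℂ → ℝ} {z : ℂ} (hz : z ∈ ball (0:ℂ) 1) :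
    planeDivWithin P Q z = planeDiv P Q z := by
  simp only [planeDivWithin, planeDiv, fderivWithin_of_mem_nhds (closedDisk_mem_nhds hz)]

lemma continuousOn_planeDivWithin {P Q : ℂ → ℝ} (hP : ContDiffOn ℝ 1 P (closedBall 0 1))
    (hQ : ContDiffOn ℝ 1 Q (closedBall 0 1)) :
    ContinuousOn (planeDivWithin P Q) (closedBall 0 1) := by
  have h1 := hP.continuousOn_fderivWithin uniqueDiffOn_closedDisk le_rfl
  have h2 := hQ.continuousOn_fderivWithin uniqueDiffOn_closedDisk le_rfl
  exact (h1.clm_apply continuousOn_const).add (h2.clm_apply continuousOn_const)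

lemma integrableOn_planeDiv {P Q : ℂ → ℝ} (hP : ContDiffOn ℝ 1 P (closedBall 0 1))
    (hQ : ContDiffOn ℝ 1 Q (closedBall 0 1)) :
    IntegrableOn (planeDiv P Q) (ball 0 1) := by
  have h := ((continuousOn_planeDivWithin hP hQ).integrableOn_compact
    (μ := volume) (isCompact_closedBall _ _)).mono_set ball_subset_closedBall
  exact h.congr_fun (fun z hz => planeDivWithin_eq hz) measurableSet_ball

/-- Polar coordinates as a map defined on all of `ℝ × ℝ`. -/
def polarMap (p : ℝ × ℝ) : ℂ := p.1 * (Real.cos p.2 + Real.sin p.2 * I)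

lemma norm_polarMap (p : ℝ × ℝ) : ‖polarMap p‖ = |p.1| := by
  have h : ((Real.cos p.2 : ℂ) + Real.sin p.2 * I) = Complex.exp (p.2 * I) := by
    rw [Complex.exp_mul_I]; simp
  simp only [polarMap, h, norm_mul, Complex.norm_real, Complex.norm_exp_ofReal_mul_I, mul_one,
    Real.norm_eq_abs]

lemma continuous_polarMap : Continuous polarMap := by
  unfold polarMap; fun_prop

lemma integral_unitDisk_polar (F : ℂ → ℝ) (hF : ContinuousOn F (closedBall 0 1)) :
    ∫ z in ball (0:ℂ) 1, F z =
      ∫ r in (0:ℝ)..1, ∫ θ in (-Real.pi)..Real.pi, r * F (polarMap (r, θ)) := by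
  have hint : IntegrableOn (fun p : ℝ × ℝ => p.1 * F (polarMap p))
      (Icc 0 1 ×ˢ Icc (-Real.pi) Real.pi) := by
    refine ContinuousOn.integrableOn_compact (isCompact_Icc.prod isCompact_Icc) ?_
    refine continuousOn_fst.mul (hF.comp continuous_polarMap.continuousOn ?_)
    rintro p ⟨⟨h1, h2⟩, -⟩
    simp [norm_polarMap, abs_of_nonneg h1, h2]
  rw [intervalIntegral.integral_of_le zero_le_one]
  simp only [intervalIntegral.integral_of_le (by linarith [Real.pi_pos] : -Real.pi ≤ Real.pi)]
  rw [← setIntegral_prod (fun p : ℝ × ℝ => p.1 * F (polarMap p))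
    (hint.mono_set (prod_mono Ioc_subset_Icc_self Ioc_subset_Icc_self))]
  rw [← integral_indicator measurableSet_ball, ← Complex.integral_comp_polarCoord_symm,
    show polarCoord.target = Ioi (0:ℝ) ×ˢ Ioo (-Real.pi) Real.pi from rfl,
    ← integral_indicator (by measurability)]
  rw [← integral_indicator (by measurability), ← Measure.volume_eq_prod]
  have hpi : ∀ᵐ p : ℝ × ℝ, p.1 ≠ 1 ∧ p.2 ≠ Real.pi := by
    have e1 : ∀ᵐ x : ℝ, x ≠ 1 := by simp [ae_iff]
    have e2 : ∀ᵐ x : ℝ, x ≠ Real.pi := by simp [ae_iff]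
    exact (Measure.quasiMeasurePreserving_fst.ae e1).and (Measure.quasiMeasurePreserving_snd.ae e2)
  refine integral_congr_ae ?_
  filter_upwards [hpi] with p hp
  have hE : Complex.polarCoord.symm p = polarMap p := Complex.polarCoord_symm_apply p
  simp only [indicator, hE, mem_prod, mem_Ioi, mem_Ioo, mem_Ioc, mem_ball_zero_iff, norm_polarMap,
    smul_eq_mul]
  by_cases h0 : 0 < p.1
  · rw [abs_of_pos h0]
    have a1 : p.1 ≤ 1 ↔ p.1 < 1 := ⟨fun h => lt_of_le_of_ne h hp.1, le_of_lt⟩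
    have a2 : p.2 ≤ Real.pi ↔ p.2 < Real.pi := ⟨fun h => lt_of_le_of_ne h hp.2, le_of_lt⟩
    simp only [a1, a2]
    split_ifs <;> simp_all
  · simp [h0]

/-- The divergence theorem on the unit disk, for fields that are `C¹` up to the boundary. -/
theorem integral_planeDiv {P Q : ℂ → ℝ} (hP : ContDiffOn ℝ 1 P (closedBall 0 1))
    (hQ : ContDiffOn ℝ 1 Q (closedBall 0 1)) :
    ∫ z in ball (0:ℂ) 1, planeDiv P Q z =
      ∫ θ in (-Real.pi)..Real.pi, (P (polarMap (1, θ)) * Real.cos θ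
        + Q (polarMap (1, θ)) * Real.sin θ) := by
  rw [← setIntegral_congr_fun measurableSet_ball (fun z hz => planeDivWithin_eq hz),
    integral_unitDisk_polar _ (continuousOn_planeDivWithin hP hQ)]
  have hmaps : MapsTo polarMap (uIcc 0 1 ×ˢ uIcc (-Real.pi) Real.pi) (closedBall 0 1) := by
    rintro p ⟨h1, -⟩
    rw [uIcc_of_le zero_le_one] at h1
    simp [norm_polarMap, abs_of_nonneg h1.1, h1.2]
  have hPc := hP.continuousOn.comp continuous_polarMap.continuousOn hmaps
  have hQc := hQ.continuousOn.comp continuous_polarMap.continuousOn hmaps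
  set F : ℝ × ℝ → ℝ := fun p =>
    p.1 * (P (polarMap p) * Real.cos p.2 + Q (polarMap p) * Real.sin p.2) with hF
  set G : ℝ × ℝ → ℝ := fun p =>
    Q (polarMap p) * Real.cos p.2 - P (polarMap p) * Real.sin p.2 with hG
  have hdiff : ∀ p ∈ Ioo (min (0:ℝ) 1) (max 0 1) ×ˢ
      Ioo (min (-Real.pi) Real.pi) (max (-Real.pi) Real.pi) \ (∅ : Set (ℝ × ℝ)),
      DifferentiableAt ℝ F p ∧ DifferentiableAt ℝ G p ∧
      fderiv ℝ F p (1, 0) + fderiv ℝ G p (0, 1) = p.1 * planeDivWithin P Q (polarMap p) := by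
    rintro ⟨r, t⟩ ⟨⟨hr, -⟩, -⟩
    simp only [min_eq_left zero_le_one, max_eq_right zero_le_one, mem_Ioo] at hr
    have hz : polarMap (r, t) ∈ ball (0:ℂ) 1 := by
      simpa [norm_polarMap, abs_of_pos hr.1] using hr.2
    have hPz : DifferentiableAt ℝ P (polarMap (r, t)) :=
      (hP.differentiableOn one_ne_zero).differentiableAt (closedDisk_mem_nhds hz)
    have hQz : DifferentiableAt ℝ Q (polarMap (r, t)) :=
      (hQ.differentiableOn one_ne_zero).differentiableAt (closedDisk_mem_nhds hz)
    have hpol : DifferentiableAt ℝ polarMap (r, t) := by unfold polarMap; fun_prop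
    have hPd : DifferentiableAt ℝ (fun p => P (polarMap p)) (r, t) := hPz.comp (r, t) hpol
    have hQd : DifferentiableAt ℝ (fun p => Q (polarMap p)) (r, t) := hQz.comp (r, t) hpol
    have hFd : DifferentiableAt ℝ F (r, t) := by rw [hF]; fun_prop
    have hGd : DifferentiableAt ℝ G (r, t) := by rw [hG]; fun_prop
    refine ⟨hFd, hGd, ?_⟩
    have hr1 : HasDerivAt (fun x : ℝ => ((x, t) : ℝ × ℝ)) (1, 0) r :=
      (hasDerivAt_id r).prodMk (hasDerivAt_const r t)
    have ht1 : HasDerivAt (fun x : ℝ => ((r, x) : ℝ × ℝ)) (0, 1) t :=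
      (hasDerivAt_const t r).prodMk (hasDerivAt_id t)
    have polr : HasDerivAt (fun x : ℝ => polarMap (x, t))
        (Real.cos t + Real.sin t * I) r := by
      unfold polarMap
      simpa using ((hasDerivAt_id r).ofReal_comp).mul_const ((Real.cos t : ℂ) + Real.sin t * I)
    have polt : HasDerivAt (fun x : ℝ => polarMap (r, x))
        (r * ((-Real.sin t : ℝ) + (Real.cos t : ℝ) * I)) t := by
      unfold polarMap
      exact (((Real.hasDerivAt_cos t).ofReal_comp).add
        (((Real.hasDerivAt_sin t).ofReal_comp).mul_const I)).const_mul (r : ℂ)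
    have lin : ∀ (L : ℂ →L[ℝ] ℝ) (a b : ℝ), L (a + b * I) = a * L 1 + b * L I := by
      intro L a b
      rw [show (a + b * I : ℂ) = a • (1:ℂ) + b • I by simp, map_add, map_smul, map_smul]
      simp
    have Pr : HasDerivAt (fun x => P (polarMap (x, t))) _ r :=
      hPz.hasFDerivAt.comp_hasDerivAt r polr
    have Qr : HasDerivAt (fun x => Q (polarMap (x, t))) _ r :=
      hQz.hasFDerivAt.comp_hasDerivAt r polr
    have Pt : HasDerivAt (fun x => P (polarMap (r, x))) _ t :=
      hPz.hasFDerivAt.comp_hasDerivAt t polt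
    have Qt : HasDerivAt (fun x => Q (polarMap (r, x))) _ t :=
      hQz.hasFDerivAt.comp_hasDerivAt t polt
    rw [show (r * ((-Real.sin t : ℝ) + (Real.cos t : ℝ) * I) : ℂ)
      = (-r * Real.sin t : ℝ) + (r * Real.cos t : ℝ) * I by push_cast; ring] at Pt Qt
    rw [lin] at Pr Qr Pt Qt
    have dF : HasDerivAt (fun x => F (x, t)) _ r :=
      (hasDerivAt_id r).mul ((Pr.mul_const (Real.cos t)).add (Qr.mul_const (Real.sin t)))
    have dG : HasDerivAt (fun x => G (r, x)) _ t :=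
      (Qt.mul (Real.hasDerivAt_cos t)).sub (Pt.mul (Real.hasDerivAt_sin t))
    have cF : HasDerivAt (F ∘ fun x => (x, t)) (fderiv ℝ F (r, t) (1, 0)) r :=
      hFd.hasFDerivAt.comp_hasDerivAt r hr1
    have cG : HasDerivAt (G ∘ fun x => (r, x)) (fderiv ℝ G (r, t) (0, 1)) t :=
      hGd.hasFDerivAt.comp_hasDerivAt t ht1
    rw [cF.unique dF, cG.unique dG, planeDivWithin_eq hz, planeDiv]
    simp only [id]
    linear_combination (r * fderiv ℝ P (polarMap (r, t)) 1 + r * fderiv ℝ Q (polarMap (r, t)) I) *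
      Real.cos_sq_add_sin_sq t
  have key := integral2_divergence_prod_of_hasFDerivAt_off_countable F G (fderiv ℝ F) (fderiv ℝ G)
    0 (-Real.pi) 1 Real.pi ∅ countable_empty ?_ ?_ (fun p hp => (hdiff p hp).1.hasFDerivAt)
    (fun p hp => (hdiff p hp).2.1.hasFDerivAt) ?_
  · have hper : ∀ x : ℝ, G (x, Real.pi) = G (x, -Real.pi) := by
      intro x; simp [hG, polarMap]
    simp only [hper, sub_self, zero_add] at key
    have hF0 : ∀ y, F (0, y) = 0 := by simp [hF]
    have hF1 : ∀ y, F (1, y) = P (polarMap (1, y)) * Real.cos y +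
      Q (polarMap (1, y)) * Real.sin y :=
      by simp [hF]
    simp only [hF0, hF1, intervalIntegral.integral_zero, sub_zero] at key
    rw [← key]
    have hpi : -Real.pi ≤ Real.pi := by linarith [Real.pi_pos]
    simp only [intervalIntegral.integral_of_le zero_le_one, intervalIntegral.integral_of_le hpi,
      integral_Ioc_eq_integral_Ioo]
    refine setIntegral_congr_fun measurableSet_Ioo fun r hr =>
      setIntegral_congr_fun measurableSet_Ioo fun t ht => ?_
    refine ((hdiff (r, t) ⟨⟨?_, ?_⟩, fun h => h⟩).2.2).symm
    · simpa using hr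
    · rwa [min_eq_left hpi, max_eq_right hpi]
  · exact continuousOn_fst.mul ((hPc.mul (by fun_prop)).add (hQc.mul (by fun_prop)))
  · exact (hQc.mul (by fun_prop)).sub (hPc.mul (by fun_prop))
  · have hpi : -Real.pi ≤ Real.pi := by linarith [Real.pi_pos]
    have hc : IntegrableOn (fun p : ℝ × ℝ => p.1 * planeDivWithin P Q (polarMap p))
        (uIcc 0 1 ×ˢ uIcc (-Real.pi) Real.pi) :=
      ContinuousOn.integrableOn_compact (isCompact_uIcc.prod isCompact_uIcc)
        (continuousOn_fst.mul ((continuousOn_planeDivWithin hP hQ).comp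
          continuous_polarMap.continuousOn hmaps))
    refine hc.congr_fun_ae ?_
    have hsub : (uIcc 0 1 ×ˢ uIcc (-Real.pi) Real.pi : Set (ℝ × ℝ)) =ᵐ[volume]
        (Ioo 0 1 ×ˢ Ioo (-Real.pi) Real.pi : Set (ℝ × ℝ)) := by
      rw [uIcc_of_le zero_le_one, uIcc_of_le hpi]
      exact (Measure.set_prod_ae_eq Ioo_ae_eq_Icc Ioo_ae_eq_Icc).symm
    rw [Measure.restrict_congr_set hsub]
    filter_upwards [ae_restrict_mem (measurableSet_Ioo.prod measurableSet_Ioo)] with p hp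
    refine ((hdiff p ⟨⟨?_, ?_⟩, fun h => h⟩).2.2).symm
    · simpa using hp.1
    · rw [min_eq_left hpi, max_eq_right hpi]; exact hp.2

/-- A smooth cutoff vanishing on the disk of squared radius `ρ` about `ζ` and equal to `1` outside
the disk of squared radius `2ρ`. -/
def cutoff (ζ : ℂ) (ρ : ℝ) (z : ℂ) : ℝ := Real.smoothTransition (‖z - ζ‖ ^ 2 / ρ - 1)

lemma contDiff_cutoff (ζ : ℂ) (ρ : ℝ) : ContDiff ℝ 1 (cutoff ζ ρ) := by
  have h : ContDiff ℝ 1 (fun z : ℂ => ‖z - ζ‖ ^ 2 / ρ - 1) :=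
    (((contDiff_id.sub contDiff_const).norm_sq ℝ).div_const ρ).sub contDiff_const
  exact (Real.smoothTransition.contDiff (n := 1)).comp h

lemma cutoff_of_le {ζ z : ℂ} {ρ : ℝ} (hρ : 0 < ρ) (h : ‖z - ζ‖ ^ 2 ≤ ρ) : cutoff ζ ρ z = 0 :=
  Real.smoothTransition.zero_of_nonpos (by rw [sub_nonpos, div_le_one hρ]; exact h)

lemma cutoff_of_ge {ζ z : ℂ} {ρ : ℝ} (hρ : 0 < ρ) (h : 2 * ρ ≤ ‖z - ζ‖ ^ 2) : cutoff ζ ρ z = 1 :=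
  Real.smoothTransition.one_of_one_le (by
    have : 2 ≤ ‖z - ζ‖ ^ 2 / ρ := by rwa [le_div_iff₀ hρ]
    linarith)

lemma abs_cutoff_le (ζ : ℂ) (ρ : ℝ) (z : ℂ) : |cutoff ζ ρ z| ≤ 1 := by
  rw [cutoff, abs_of_nonneg (Real.smoothTransition.nonneg _)]
  exact Real.smoothTransition.le_one _

lemma cutoff_eventuallyEq_zero {ζ : ℂ} {ρ : ℝ} (hρ : 0 < ρ) : cutoff ζ ρ =ᶠ[nhds ζ] 0 := by
  have hc : Continuous fun z : ℂ => ‖z - ζ‖ ^ 2 := by fun_prop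
  filter_upwards [(isOpen_lt hc continuous_const).mem_nhds (show ‖ζ - ζ‖ ^ 2 < ρ by simpa)]
    with z hz
  exact cutoff_of_le hρ (le_of_lt hz)

lemma exists_bound_deriv_smoothTransition :
    ∃ C, 0 ≤ C ∧ ∀ x, |deriv Real.smoothTransition x| ≤ C := by
  have hc : Continuous (deriv Real.smoothTransition) :=
    (Real.smoothTransition.contDiff (n := 1)).continuous_deriv le_rfl
  obtain ⟨C, hC⟩ := isCompact_Icc.exists_bound_of_continuousOn (s := Icc (0:ℝ) 1) hc.continuousOn
  have hC0 : 0 ≤ C := (norm_nonneg _).trans (hC 0 (by simp))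
  refine ⟨C, hC0, fun x => ?_⟩
  by_cases h0 : x < 0
  · have : Real.smoothTransition =ᶠ[nhds x] fun _ => 0 := by
      filter_upwards [Iio_mem_nhds h0] with y hy
      exact Real.smoothTransition.zero_of_nonpos (le_of_lt hy)
    simpa [this.deriv_eq] using hC0
  by_cases h1 : 1 < x
  · have : Real.smoothTransition =ᶠ[nhds x] fun _ => 1 := by
      filter_upwards [Ioi_mem_nhds h1] with y hy
      exact Real.smoothTransition.one_of_one_le (le_of_lt hy)
    simpa [this.deriv_eq] using hC0
  exact hC x ⟨not_lt.1 h0, not_lt.1 h1⟩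

lemma exists_bound_fderiv_cutoff : ∃ C, 0 ≤ C ∧ ∀ (ζ z : ℂ) (ρ : ℝ), 0 < ρ →
    ‖fderiv ℝ (cutoff ζ ρ) z‖ ≤ C * ‖z - ζ‖ / ρ := by
  obtain ⟨C, hC0, hC⟩ := exists_bound_deriv_smoothTransition
  refine ⟨C * 2, by positivity, fun ζ z ρ hρ => ?_⟩
  have h1 : HasFDerivAt (fun z : ℂ => ‖z - ζ‖ ^ 2 / ρ - 1)
      ((ρ⁻¹ : ℝ) • (2 • innerSL ℝ (z - ζ))) z := by
    have h := ((hasStrictFDerivAt_norm_sq (z - ζ)).hasFDerivAt.comp z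
      ((hasFDerivAt_id z).sub_const ζ)).const_mul (ρ⁻¹)
    simpa [div_eq_inv_mul, Function.comp_def] using h.sub_const 1
  have h2 : HasDerivAt Real.smoothTransition _ (‖z - ζ‖ ^ 2 / ρ - 1) :=
    ((Real.smoothTransition.contDiff (n := 1)).differentiable one_ne_zero _).hasDerivAt
  have h3 : HasFDerivAt (cutoff ζ ρ) _ z := h2.comp_hasFDerivAt z h1
  rw [h3.fderiv, norm_smul, norm_smul, Real.norm_eq_abs, Real.norm_eq_abs, abs_inv, abs_of_pos hρ,
    ← Nat.cast_smul_eq_nsmul ℝ, norm_smul, innerSL_apply_norm]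
  calc _ ≤ C * (ρ⁻¹ * (‖((2:ℕ):ℝ)‖ * ‖z - ζ‖)) := by gcongr; exact hC _
    _ = C * 2 * ‖z - ζ‖ / ρ := by simp; ring

lemma contDiffOn_cutoff_mul {P : ℂ → ℝ} {ζ : ℂ} {ρ : ℝ} (hρ : 0 < ρ)
    (hP : ContDiffOn ℝ 1 P (closedBall 0 1 \ {ζ})) :
    ContDiffOn ℝ 1 (fun z => cutoff ζ ρ z * P z) (closedBall 0 1) := by
  intro z hz
  by_cases h : z = ζ
  · subst h
    have : (fun w => cutoff z ρ w * P w) =ᶠ[nhds z] fun _ => 0 := by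
      filter_upwards [cutoff_eventuallyEq_zero (ζ := z) hρ] with w hw
      simp [hw]
    exact (contDiffAt_const.congr_of_eventuallyEq this).contDiffWithinAt
  · have h1 : ContDiffWithinAt ℝ 1 P (closedBall 0 1) z := by
      refine (hP z ⟨hz, h⟩).mono_of_mem_nhdsWithin ?_
      exact Filter.inter_mem self_mem_nhdsWithin
        (mem_nhdsWithin_of_mem_nhds (isOpen_compl_singleton.mem_nhds h))
    exact (contDiff_cutoff ζ ρ).contDiffAt.contDiffWithinAt.mul h1

lemma planeDiv_cutoff_mul {P Q : ℂ → ℝ} {ζ z : ℂ} {ρ : ℝ} (hP : DifferentiableAt ℝ P z)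
    (hQ : DifferentiableAt ℝ Q z) :
    planeDiv (fun z => cutoff ζ ρ z * P z) (fun z => cutoff ζ ρ z * Q z) z
      - cutoff ζ ρ z * planeDiv P Q z
      = P z * fderiv ℝ (cutoff ζ ρ) z 1 + Q z * fderiv ℝ (cutoff ζ ρ) z I := by
  have hc : DifferentiableAt ℝ (cutoff ζ ρ) z :=
    (contDiff_cutoff ζ ρ).differentiable one_ne_zero z
  simp only [planeDiv]
  rw [fderiv_fun_mul hc hP, fderiv_fun_mul hc hQ]
  simp
  ring

lemma norm_setIntegral_cutoff_error_le {P Q : ℂ → ℝ} {ζ : ℂ} {ρ τ C : ℝ} (hρ : 0 < ρ)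
    (hC : 0 ≤ C) (hτ : 0 ≤ τ)
    (hb : ∀ (z : ℂ), ‖fderiv ℝ (cutoff ζ ρ) z‖ ≤ C * ‖z - ζ‖ / ρ)
    (hV : ∀ z, z ≠ ζ → ‖z - ζ‖ ^ 2 ≤ 2 * ρ → |‖z - ζ‖ * P z| ≤ τ ∧ |‖z - ζ‖ * Q z| ≤ τ)
    {s : Set ℂ} (hs : MeasurableSet s) :
    |∫ z in s, (P z * fderiv ℝ (cutoff ζ ρ) z 1 + Q z * fderiv ℝ (cutoff ζ ρ) z I)|
      ≤ 4 * C * τ * Real.pi := by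
  have hset : ∫ z in s, (P z * fderiv ℝ (cutoff ζ ρ) z 1 + Q z * fderiv ℝ (cutoff ζ ρ) z I)
      = ∫ z in s ∩ closedBall ζ (√(2 * ρ)),
        (P z * fderiv ℝ (cutoff ζ ρ) z 1 + Q z * fderiv ℝ (cutoff ζ ρ) z I) := by
    refine setIntegral_eq_of_subset_of_forall_sdiff_eq_zero hs inter_subset_left ?_
    rintro z ⟨hz, hz'⟩
    have hfar : 2 * ρ < ‖z - ζ‖ ^ 2 := by
      have : √(2 * ρ) < ‖z - ζ‖ := by
        by_contra! h
        exact hz' ⟨hz, by rwa [mem_closedBall, dist_eq_norm]⟩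
      exact (Real.sqrt_lt' (lt_of_le_of_lt (Real.sqrt_nonneg _) this)).1 this
    have hc : Continuous fun w : ℂ => ‖w - ζ‖ ^ 2 := by fun_prop
    have : cutoff ζ ρ =ᶠ[nhds z] fun _ => 1 := by
      filter_upwards [(isOpen_lt continuous_const hc).mem_nhds hfar] with w hw
      exact cutoff_of_ge hρ (le_of_lt hw)
    simp [this.fderiv_eq]
  rw [hset, ← Real.norm_eq_abs]
  have hvol : volume.real (closedBall ζ (√(2 * ρ))) = 2 * ρ * Real.pi := by
    rw [Measure.real, Complex.volume_closedBall, ENNReal.toReal_mul, ENNReal.toReal_pow,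
      ENNReal.toReal_ofReal (Real.sqrt_nonneg _), Real.sq_sqrt (by positivity)]
    simp
  have hbound : ∀ z ∈ s ∩ closedBall ζ (√(2 * ρ)),
      ‖P z * fderiv ℝ (cutoff ζ ρ) z 1 + Q z * fderiv ℝ (cutoff ζ ρ) z I‖ ≤ 2 * C * τ / ρ := by
    rintro z ⟨-, hz⟩
    by_cases h : z = ζ
    · subst h
      have : fderiv ℝ (cutoff z ρ) z = 0 := by
        have := hb z
        simpa using this
      rw [this]; simp; positivity
    · have hn : ‖z - ζ‖ ^ 2 ≤ 2 * ρ := by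
        rw [mem_closedBall, dist_eq_norm] at hz
        exact (Real.le_sqrt' (norm_pos_iff.2 (sub_ne_zero.2 h))).1 hz
      obtain ⟨h1, h2⟩ := hV z h hn
      have e1 : |fderiv ℝ (cutoff ζ ρ) z 1| ≤ C * ‖z - ζ‖ / ρ := by
        refine ((fderiv ℝ (cutoff ζ ρ) z).le_opNorm 1).trans ?_
        simpa using hb z
      have e2 : |fderiv ℝ (cutoff ζ ρ) z I| ≤ C * ‖z - ζ‖ / ρ := by
        refine ((fderiv ℝ (cutoff ζ ρ) z).le_opNorm I).trans ?_
        simpa using hb z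
      rw [abs_mul, abs_of_nonneg (norm_nonneg _)] at h1 h2
      calc _ ≤ |P z| * |fderiv ℝ (cutoff ζ ρ) z 1| + |Q z| * |fderiv ℝ (cutoff ζ ρ) z I| := by
            rw [← abs_mul, ← abs_mul]; exact abs_add_le _ _
        _ ≤ |P z| * (C * ‖z - ζ‖ / ρ) + |Q z| * (C * ‖z - ζ‖ / ρ) := by gcongr
        _ = C / ρ * (‖z - ζ‖ * |P z| + ‖z - ζ‖ * |Q z|) := by ring
        _ ≤ C / ρ * (τ + τ) := by gcongr
        _ = 2 * C * τ / ρ := by ring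
  have hfin : volume (closedBall ζ (√(2 * ρ))) < ⊤ := measure_closedBall_lt_top
  refine (norm_setIntegral_le_of_norm_le_const
    ((measure_mono inter_subset_right).trans_lt hfin) hbound).trans ?_
  calc _ ≤ 2 * C * τ / ρ * volume.real (closedBall ζ (√(2 * ρ))) := by
        gcongr
        exacts [hfin.ne, inter_subset_right]
    _ = 4 * C * τ * Real.pi := by rw [hvol]; field_simp; ring

/-- The divergence theorem on the unit disk for a field with a singularity of order `o(1/|z - ζ|)`
at one interior point `ζ`. -/
theorem integral_planeDiv_of_punctured {P Q : ℂ → ℝ} {ζ : ℂ} (hζ : ζ ∈ ball (0:ℂ) 1)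
    (hP : ContDiffOn ℝ 1 P (closedBall 0 1 \ {ζ})) (hQ : ContDiffOn ℝ 1 Q (closedBall 0 1 \ {ζ}))
    (hD : IntegrableOn (planeDiv P Q) (ball 0 1))
    (hP0 : Filter.Tendsto (fun z => ‖z - ζ‖ * P z) (nhdsWithin ζ {ζ}ᶜ) (nhds 0))
    (hQ0 : Filter.Tendsto (fun z => ‖z - ζ‖ * Q z) (nhdsWithin ζ {ζ}ᶜ) (nhds 0)) :
    ∫ z in ball (0:ℂ) 1, planeDiv P Q z =
      ∫ θ in (-Real.pi)..Real.pi, (P (polarMap (1, θ)) * Real.cos θ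
        + Q (polarMap (1, θ)) * Real.sin θ) := by
  obtain ⟨C, hC0, hC⟩ := exists_bound_fderiv_cutoff
  set Φ := ∫ θ in (-Real.pi)..Real.pi, (P (polarMap (1, θ)) * Real.cos θ
        + Q (polarMap (1, θ)) * Real.sin θ) with hΦ
  have hdiff : ∀ (z : ℂ), z ∈ ball (0:ℂ) 1 → z ≠ ζ →
      DifferentiableAt ℝ P z ∧ DifferentiableAt ℝ Q z := by
    intro z hz hne
    have hn : closedBall 0 1 \ {ζ} ∈ nhds z :=
      Filter.inter_mem (closedDisk_mem_nhds hz) (isOpen_compl_singleton.mem_nhds hne)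
    exact ⟨(hP.differentiableOn one_ne_zero).differentiableAt hn,
      (hQ.differentiableOn one_ne_zero).differentiableAt hn⟩
  have hne : ∀ᵐ z ∂(volume.restrict (ball (0:ℂ) 1)), z ≠ ζ :=
    ae_restrict_of_ae (by simp [ae_iff])
  have lim1 : Filter.Tendsto (fun ρ => ∫ z in ball (0:ℂ) 1, cutoff ζ ρ z * planeDiv P Q z)
      (nhdsWithin 0 (Ioi 0)) (nhds (∫ z in ball (0:ℂ) 1, planeDiv P Q z)) := by
    refine tendsto_integral_filter_of_dominated_convergence (fun z => ‖planeDiv P Q z‖) ?_ ?_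
      hD.norm ?_
    · exact Filter.Eventually.of_forall fun ρ =>
        (contDiff_cutoff ζ ρ).continuous.aestronglyMeasurable.mul hD.1
    · refine Filter.Eventually.of_forall fun ρ => Filter.Eventually.of_forall fun z => ?_
      rw [norm_mul]
      exact mul_le_of_le_one_left (norm_nonneg _) (abs_cutoff_le ζ ρ z)
    · filter_upwards [hne] with z hz
      refine tendsto_const_nhds.congr' ?_
      have hpos : 0 < ‖z - ζ‖ ^ 2 / 2 := by
        have := norm_pos_iff.2 (sub_ne_zero.2 hz); positivity
      filter_upwards [self_mem_nhdsWithin, mem_nhdsWithin_of_mem_nhds (Iio_mem_nhds hpos)]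
        with ρ h1 h2
      rw [cutoff_of_ge h1 (by simp only [mem_Iio] at h2; linarith), one_mul]
  have lim2 : Filter.Tendsto (fun ρ => ∫ z in ball (0:ℂ) 1, cutoff ζ ρ z * planeDiv P Q z)
      (nhdsWithin 0 (Ioi 0)) (nhds Φ) := by
    rw [Metric.tendsto_nhds]
    intro ε hε
    set τ := ε / (8 * (C + 1) * Real.pi) with hτ
    have hτ0 : 0 < τ := by have := Real.pi_pos; positivity
    have hev := (Metric.tendsto_nhds.1 hP0 τ hτ0).and (Metric.tendsto_nhds.1 hQ0 τ hτ0)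
    rw [eventually_nhdsWithin_iff, Metric.eventually_nhds_iff] at hev
    obtain ⟨δ, hδ, hev⟩ := hev
    rw [mem_ball_zero_iff] at hζ
    filter_upwards [self_mem_nhdsWithin,
      mem_nhdsWithin_of_mem_nhds (Iio_mem_nhds (by positivity : 0 < δ ^ 2 / 2)),
      mem_nhdsWithin_of_mem_nhds (Iio_mem_nhds (by positivity : 0 < (1 - ‖ζ‖) ^ 2 / 2))]
      with ρ h0 h1 h2
    simp only [mem_Iio, mem_Ioi] at h0 h1 h2
    have hPc := contDiffOn_cutoff_mul (ζ := ζ) h0 hP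
    have hQc := contDiffOn_cutoff_mul (ζ := ζ) h0 hQ
    have hmain := integral_planeDiv hPc hQc
    have hflux : ∀ θ : ℝ, cutoff ζ ρ (polarMap (1, θ)) = 1 := by
      intro θ
      refine cutoff_of_ge h0 ?_
      have h3 : 1 - ‖ζ‖ ≤ ‖polarMap (1, θ) - ζ‖ := by
        have := norm_sub_norm_le (polarMap (1, θ)) ζ
        rwa [norm_polarMap, abs_one] at this
      have : (1 - ‖ζ‖) ^ 2 ≤ ‖polarMap (1, θ) - ζ‖ ^ 2 := by gcongr
      linarith
    simp only [hflux, one_mul] at hmain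
    rw [← hΦ] at hmain
    have hint : IntegrableOn (fun z => cutoff ζ ρ z * planeDiv P Q z) (ball 0 1) :=
      hD.bdd_mul (c := 1) (contDiff_cutoff ζ ρ).continuous.aestronglyMeasurable
        (Filter.Eventually.of_forall fun z => abs_cutoff_le ζ ρ z)
    have herr := integral_sub (integrableOn_planeDiv hPc hQc) hint
    rw [hmain] at herr
    have hcongr : ∫ z in ball (0:ℂ) 1, (planeDiv (fun z => cutoff ζ ρ z * P z)
        (fun z => cutoff ζ ρ z * Q z) z - cutoff ζ ρ z * planeDiv P Q z) =
        ∫ z in ball (0:ℂ) 1,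
          (P z * fderiv ℝ (cutoff ζ ρ) z 1 + Q z * fderiv ℝ (cutoff ζ ρ) z I) := by
      refine integral_congr_ae ?_
      filter_upwards [hne, ae_restrict_mem measurableSet_ball] with z hz hz'
      exact planeDiv_cutoff_mul (hdiff z hz' hz).1 (hdiff z hz' hz).2
    have hle := norm_setIntegral_cutoff_error_le h0 hC0 hτ0.le (fun z => hC ζ z ρ h0)
      (P := P) (Q := Q) ?_ (measurableSet_ball (x := (0:ℂ)) (ε := 1))
    · rw [dist_comm, Real.dist_eq, ← herr, hcongr]
      refine hle.trans_lt ?_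
      have hpi := Real.pi_pos
      have : 4 * C * τ * Real.pi = ε * (C / (2 * (C + 1))) := by
        rw [hτ]; field_simp; ring
      rw [this]
      refine mul_lt_of_lt_one_right hε ?_
      rw [div_lt_one (by positivity)]
      linarith
    · intro z hz hz2
      have hdist : dist z ζ < δ := by
        rw [dist_eq_norm]
        exact lt_of_pow_lt_pow_left₀ 2 hδ.le (by linarith)
      obtain ⟨a, b⟩ := hev hdist hz
      rw [Real.dist_0_eq_abs] at a b
      exact ⟨a.le, b.le⟩
  exact tendsto_nhds_unique lim1 lim2

/-- `f` has gradient `(p, q)` at `z`. -/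
def HasGrad (f : ℂ → ℝ) (p q : ℝ) (z : ℂ) : Prop :=
  HasFDerivAt f (p • reCLM + q • imCLM) z

namespace HasGrad

variable {f g : ℂ → ℝ} {p q p' q' : ℝ} {z : ℂ}

lemma fderiv_one (h : HasGrad f p q z) : fderiv ℝ f z 1 = p := by
  rw [HasFDerivAt.fderiv h]; simp

lemma fderiv_I (h : HasGrad f p q z) : fderiv ℝ f z I = q := by
  rw [HasFDerivAt.fderiv h]; simp

lemma re (z : ℂ) : HasGrad Complex.re 1 0 z := by
  exact (reCLM.hasFDerivAt (x := z)).congr_fderiv (by ext; simp)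

lemma im (z : ℂ) : HasGrad Complex.im 0 1 z := by
  exact (imCLM.hasFDerivAt (x := z)).congr_fderiv (by ext; simp)

lemma const (c : ℝ) (z : ℂ) : HasGrad (fun _ => c) 0 0 z := by
  simpa [HasGrad] using hasFDerivAt_const c z

lemma congr_grad (h : HasGrad f p q z) (hp : p = p') (hq : q = q') : HasGrad f p' q' z := by
  rwa [← hp, ← hq]

lemma add (hf : HasGrad f p q z) (hg : HasGrad g p' q' z) :
    HasGrad (fun w => f w + g w) (p + p') (q + q') z :=
  (HasFDerivAt.add hf hg).congr_fderiv (by ext; simp; ring)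

lemma sub (hf : HasGrad f p q z) (hg : HasGrad g p' q' z) :
    HasGrad (fun w => f w - g w) (p - p') (q - q') z :=
  (HasFDerivAt.sub hf hg).congr_fderiv (by ext; simp; ring)

lemma mul (hf : HasGrad f p q z) (hg : HasGrad g p' q' z) :
    HasGrad (fun w => f w * g w) (p * g z + f z * p') (q * g z + f z * q') z :=
  (HasFDerivAt.mul hf hg).congr_fderiv (by ext; simp; ring)

lemma pow_two (hf : HasGrad f p q z) :
    HasGrad (fun w => f w ^ 2) (2 * f z * p) (2 * f z * q) z := by
  simp only [sq]
  exact (hf.mul hf).congr_grad (by ring) (by ring)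

lemma const_mul (c : ℝ) (hf : HasGrad f p q z) :
    HasGrad (fun w => c * f w) (c * p) (c * q) z :=
  ((const c z).mul hf).congr_grad (by ring) (by ring)

lemma inv (hf : HasGrad f p q z) (h0 : f z ≠ 0) :
    HasGrad (fun w => (f w)⁻¹) (-p / f z ^ 2) (-q / f z ^ 2) z :=
  ((hasDerivAt_inv h0).comp_hasFDerivAt z hf).congr_fderiv
    (by ext; simp; field_simp)

lemma log (hf : HasGrad f p q z) (h0 : f z ≠ 0) :
    HasGrad (fun w => Real.log (f w)) (p / f z) (q / f z) z :=
  (HasFDerivAt.log hf h0).congr_fderiv (by ext; simp; field_simp)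

end HasGrad

lemma lap_eq_of_hasGrad {F Fx Fy : ℂ → ℝ} {z : ℂ} {a b c d : ℝ}
    (h : ∀ᶠ w in nhds z, HasGrad F (Fx w) (Fy w) w) (hx : HasGrad Fx a b z)
    (hy : HasGrad Fy c d z) : lap F z = 1 / 4 * (a + d) := by
  have h1 : (fun w => fderiv ℝ F w 1) =ᶠ[nhds z] Fx := h.mono fun w hw => hw.fderiv_one
  have h2 : (fun w => fderiv ℝ F w I) =ᶠ[nhds z] Fy := h.mono fun w hw => hw.fderiv_I
  rw [lap, h1.fderiv_eq, h2.fderiv_eq, hx.fderiv_one, hy.fderiv_I]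

lemma lap_congr {u v : ℂ → ℝ} {z : ℂ} (h : u =ᶠ[nhds z] v) : lap u z = lap v z := by
  have h1 : (fun w => fderiv ℝ u w 1) =ᶠ[nhds z] fun w => fderiv ℝ v w 1 :=
    h.eventuallyEq_nhds.mono fun w hw => by simp only [hw.fderiv_eq]
  have h2 : (fun w => fderiv ℝ u w I) =ᶠ[nhds z] fun w => fderiv ℝ v w I :=
    h.eventuallyEq_nhds.mono fun w hw => by simp only [hw.fderiv_eq]
  rw [lap, lap, h1.fderiv_eq, h2.fderiv_eq]

/-- The real part of a holomorphic function is harmonic. -/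
lemma lap_re_of_analyticAt {F : ℂ → ℂ} {z : ℂ} (hF : AnalyticAt ℂ F z) :
    lap (fun w => (F w).re) z = 0 := by
  have grad : ∀ {G : ℂ → ℂ} {w : ℂ}, AnalyticAt ℂ G w →
      HasGrad (fun w => (G w).re) (deriv G w).re (-(deriv G w).im) w := by
    intro G w hG
    have h := reCLM.hasFDerivAt.comp w
      (hG.differentiableAt.hasDerivAt.hasFDerivAt.restrictScalars ℝ)
    refine HasFDerivAt.congr_fderiv h ?_
    ext; simp; ring
  have grad' : ∀ {G : ℂ → ℂ} {w : ℂ}, AnalyticAt ℂ G w →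
      HasGrad (fun w => -(G w).im) (-(deriv G w).im) (-(deriv G w).re) w := by
    intro G w hG
    have h := (imCLM.hasFDerivAt.comp w
      (hG.differentiableAt.hasDerivAt.hasFDerivAt.restrictScalars ℝ)).neg
    refine HasFDerivAt.congr_fderiv h ?_
    ext; simp; ring
  rw [lap_eq_of_hasGrad (hF.eventually_analyticAt.mono fun w hw => grad hw) (grad hF.deriv)
    (grad' hF.deriv)]
  ring

lemma contDiffAt_fderiv_apply {a : ℂ → ℝ} {z : ℂ} {m n : WithTop ℕ∞} (h : ContDiffAt ℝ n a z)
    (hmn : m + 1 ≤ n) (d : ℂ) : ContDiffAt ℝ m (fun w => fderiv ℝ a w d) z :=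
  (h.fderiv_right hmn).clm_apply contDiffAt_const

/-- Green's second identity in differential form. -/
lemma planeDiv_green {a b : ℂ → ℝ} {z : ℂ} (ha : ContDiffAt ℝ 2 a z) (hb : ContDiffAt ℝ 2 b z) :
    planeDiv (fun w => a w * fderiv ℝ b w 1 - b w * fderiv ℝ a w 1)
      (fun w => a w * fderiv ℝ b w I - b w * fderiv ℝ a w I) z
      = 4 * (a z * lap b z - b z * lap a z) := by
  have a0 : DifferentiableAt ℝ a z := ha.differentiableAt two_ne_zero
  have b0 : DifferentiableAt ℝ b z := hb.differentiableAt two_ne_zero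
  have h2 : (1 : WithTop ℕ∞) + 1 ≤ 2 := by norm_num
  have a1 : ∀ d, DifferentiableAt ℝ (fun w => fderiv ℝ a w d) z := fun d =>
    (contDiffAt_fderiv_apply ha h2 d).differentiableAt one_ne_zero
  have b1 : ∀ d, DifferentiableAt ℝ (fun w => fderiv ℝ b w d) z := fun d =>
    (contDiffAt_fderiv_apply hb h2 d).differentiableAt one_ne_zero
  simp only [planeDiv, lap]
  rw [fderiv_fun_sub (a0.fun_mul (b1 1)) (b0.fun_mul (a1 1)),
    fderiv_fun_sub (a0.fun_mul (b1 I)) (b0.fun_mul (a1 I)), fderiv_fun_mul a0 (b1 1),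
    fderiv_fun_mul b0 (a1 1), fderiv_fun_mul a0 (b1 I), fderiv_fun_mul b0 (a1 I)]
  simp
  ring

lemma lap_mul {a b : ℂ → ℝ} {z : ℂ} (ha : ContDiffAt ℝ 2 a z) (hb : ContDiffAt ℝ 2 b z) :
    lap (fun w => a w * b w) z = a z * lap b z + b z * lap a z
      + 1 / 2 * (fderiv ℝ a z 1 * fderiv ℝ b z 1 + fderiv ℝ a z I * fderiv ℝ b z I) := by
  have a0 : DifferentiableAt ℝ a z := ha.differentiableAt two_ne_zero
  have b0 : DifferentiableAt ℝ b z := hb.differentiableAt two_ne_zero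
  have h2 : (1 : WithTop ℕ∞) + 1 ≤ 2 := by norm_num
  have a1 : ∀ d, DifferentiableAt ℝ (fun w => fderiv ℝ a w d) z := fun d =>
    (contDiffAt_fderiv_apply ha h2 d).differentiableAt one_ne_zero
  have b1 : ∀ d, DifferentiableAt ℝ (fun w => fderiv ℝ b w d) z := fun d =>
    (contDiffAt_fderiv_apply hb h2 d).differentiableAt one_ne_zero
  have first : ∀ d, (fun w => fderiv ℝ (fun w => a w * b w) w d) =ᶠ[nhds z]
      fun w => a w * fderiv ℝ b w d + b w * fderiv ℝ a w d := by
    intro d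
    filter_upwards [ha.eventually (by simp), hb.eventually (by simp)] with w hwa hwb
    rw [fderiv_fun_mul (hwa.differentiableAt two_ne_zero) (hwb.differentiableAt two_ne_zero)]
    simp
  simp only [lap]
  rw [(first 1).fderiv_eq, (first I).fderiv_eq,
    fderiv_fun_add (a0.fun_mul (b1 1)) (b0.fun_mul (a1 1)),
    fderiv_fun_add (a0.fun_mul (b1 I)) (b0.fun_mul (a1 I)), fderiv_fun_mul a0 (b1 1),
    fderiv_fun_mul b0 (a1 1), fderiv_fun_mul a0 (b1 I), fderiv_fun_mul b0 (a1 I)]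
  simp
  ring

lemma lap_add {a b : ℂ → ℝ} {z : ℂ} (ha : ContDiffAt ℝ 2 a z) (hb : ContDiffAt ℝ 2 b z) :
    lap (fun w => a w + b w) z = lap a z + lap b z := by
  have h2 : (1 : WithTop ℕ∞) + 1 ≤ 2 := by norm_num
  have a1 : ∀ d, DifferentiableAt ℝ (fun w => fderiv ℝ a w d) z := fun d =>
    (contDiffAt_fderiv_apply ha h2 d).differentiableAt one_ne_zero
  have b1 : ∀ d, DifferentiableAt ℝ (fun w => fderiv ℝ b w d) z := fun d =>
    (contDiffAt_fderiv_apply hb h2 d).differentiableAt one_ne_zero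
  have first : ∀ d, (fun w => fderiv ℝ (fun w => a w + b w) w d) =ᶠ[nhds z]
      fun w => fderiv ℝ a w d + fderiv ℝ b w d := by
    intro d
    filter_upwards [ha.eventually (by simp), hb.eventually (by simp)] with w hwa hwb
    rw [fderiv_fun_add (hwa.differentiableAt two_ne_zero) (hwb.differentiableAt two_ne_zero)]
    simp
  simp only [lap]
  rw [(first 1).fderiv_eq, (first I).fderiv_eq, fderiv_fun_add (a1 1) (b1 1),
    fderiv_fun_add (a1 I) (b1 I)]
  simp
  ring

lemma lap_const (c : ℝ) (z : ℂ) : lap (fun _ => c) z = 0 := by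
  rw [lap_eq_of_hasGrad (Filter.Eventually.of_forall fun w => HasGrad.const c w)
    (HasGrad.const 0 z) (HasGrad.const 0 z)]
  simp

lemma lap_const_mul (c : ℝ) {a : ℂ → ℝ} {z : ℂ} (ha : ContDiffAt ℝ 2 a z) :
    lap (fun w => c * a w) z = c * lap a z := by
  rw [lap_mul contDiffAt_const ha, lap_const]
  simp

lemma lap_sub {a b : ℂ → ℝ} {z : ℂ} (ha : ContDiffAt ℝ 2 a z) (hb : ContDiffAt ℝ 2 b z) :
    lap (fun w => a w - b w) z = lap a z - lap b z := by
  have h : (fun w => a w - b w) = fun w => a w + (-1) * b w := by ext w; ring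
  rw [h, lap_add ha (contDiffAt_const.mul hb), lap_const_mul _ hb]
  ring

/-- `|z - ζ|²` in real coordinates. -/
def distSq (ζ z : ℂ) : ℝ := (z.re - ζ.re) ^ 2 + (z.im - ζ.im) ^ 2

/-- `|1 - ζ̄z|²` in real coordinates. -/
def denSq (ζ z : ℂ) : ℝ :=
  1 - 2 * (z.re * ζ.re + z.im * ζ.im) + (z.re ^ 2 + z.im ^ 2) * (ζ.re ^ 2 + ζ.im ^ 2)

lemma normSq_sub_eq_distSq (z ζ : ℂ) : normSq (z - ζ) = distSq ζ z := by
  simp [distSq, normSq_apply]; ring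

lemma normSq_eq_denSq (z ζ : ℂ) : normSq (1 - z * conj ζ) = denSq ζ z := by
  simp [denSq, normSq_apply]; ring

lemma distSq_eq_norm (ζ z : ℂ) : distSq ζ z = ‖z - ζ‖ ^ 2 := by
  rw [← normSq_sub_eq_distSq, normSq_eq_norm_sq]

lemma distSq_ne_zero {ζ z : ℂ} (h : z ≠ ζ) : distSq ζ z ≠ 0 := by
  rw [← normSq_sub_eq_distSq]
  exact fun h' => h (sub_eq_zero.1 (normSq_eq_zero.1 h'))

lemma denSq_pos {ζ z : ℂ} (hζ : ζ ∈ ball (0:ℂ) 1) (hz : z ∈ closedBall (0:ℂ) 1) :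
    0 < denSq ζ z := by
  rw [← normSq_eq_denSq, normSq_pos, sub_ne_zero]
  intro h
  rw [mem_ball_zero_iff] at hζ
  rw [mem_closedBall_zero_iff] at hz
  have h1 : ‖z * conj ζ‖ = 1 := by rw [← h, norm_one]
  rw [norm_mul, RCLike.norm_conj] at h1
  nlinarith [norm_nonneg z, norm_nonneg ζ]

lemma hasGrad_distSq (ζ z : ℂ) :
    HasGrad (distSq ζ) (2 * (z.re - ζ.re)) (2 * (z.im - ζ.im)) z := by
  refine (((HasGrad.re z).sub (HasGrad.const ζ.re z)).pow_two.add
    ((HasGrad.im z).sub (HasGrad.const ζ.im z)).pow_two).congr_grad ?_ ?_ <;> ring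

lemma hasGrad_denSq (ζ z : ℂ) :
    HasGrad (denSq ζ) (-2 * ζ.re + 2 * z.re * (ζ.re ^ 2 + ζ.im ^ 2))
      (-2 * ζ.im + 2 * z.im * (ζ.re ^ 2 + ζ.im ^ 2)) z := by
  refine (((HasGrad.const 1 z).sub ((((HasGrad.re z).mul (HasGrad.const ζ.re z)).add
    ((HasGrad.im z).mul (HasGrad.const ζ.im z))).const_mul 2)).add
    (((HasGrad.re z).pow_two.add (HasGrad.im z).pow_two).mul
      (HasGrad.const (ζ.re ^ 2 + ζ.im ^ 2) z))).congr_grad ?_ ?_ <;> ring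

lemma contDiff_distSq (ζ : ℂ) : ContDiff ℝ ⊤ (distSq ζ) := by
  have h1 : ContDiff ℝ ⊤ Complex.re := reCLM.contDiff
  have h2 : ContDiff ℝ ⊤ Complex.im := imCLM.contDiff
  unfold distSq; fun_prop

lemma contDiff_denSq (ζ : ℂ) : ContDiff ℝ ⊤ (denSq ζ) := by
  have h1 : ContDiff ℝ ⊤ Complex.re := reCLM.contDiff
  have h2 : ContDiff ℝ ⊤ Complex.im := imCLM.contDiff
  unfold denSq; fun_prop

lemma hasGrad_log_distSq {ζ z : ℂ} (h : z ≠ ζ) :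
    HasGrad (fun w => Real.log (distSq ζ w)) (2 * (z.re - ζ.re) / distSq ζ z)
      (2 * (z.im - ζ.im) / distSq ζ z) z :=
  (hasGrad_distSq ζ z).log (distSq_ne_zero h)

lemma lap_log_distSq {ζ z : ℂ} (h : z ≠ ζ) : lap (fun w => Real.log (distSq ζ w)) z = 0 := by
  have hN := distSq_ne_zero h
  have hi := (hasGrad_distSq ζ z).inv hN
  rw [lap_eq_of_hasGrad
    ((eventually_ne_nhds h).mono fun w hw => hasGrad_log_distSq hw)
    ((((HasGrad.re z).sub (HasGrad.const ζ.re z)).const_mul 2).mul hi)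
    ((((HasGrad.im z).sub (HasGrad.const ζ.im z)).const_mul 2).mul hi)]
  field_simp
  rw [distSq]; ring

lemma eventually_denSq_ne_zero {ζ z : ℂ} (h : denSq ζ z ≠ 0) : ∀ᶠ w in nhds z, denSq ζ w ≠ 0 :=
  (contDiff_denSq ζ).continuous.continuousAt.eventually_ne h

lemma lap_log_denSq {ζ z : ℂ} (h : denSq ζ z ≠ 0) : lap (fun w => Real.log (denSq ζ w)) z = 0 := by
  have hi := (hasGrad_denSq ζ z).inv h
  rw [lap_eq_of_hasGrad
    ((eventually_denSq_ne_zero h).mono fun w hw => (hasGrad_denSq ζ w).log hw)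
    (((HasGrad.const (-2 * ζ.re) z).add (((HasGrad.re z).const_mul 2).mul
      (HasGrad.const (ζ.re ^ 2 + ζ.im ^ 2) z))).mul hi)
    (((HasGrad.const (-2 * ζ.im) z).add (((HasGrad.im z).const_mul 2).mul
      (HasGrad.const (ζ.re ^ 2 + ζ.im ^ 2) z))).mul hi)]
  field_simp
  rw [denSq]; ring

lemma H1_eq_re {z ζ : ℂ} (h : denSq ζ z ≠ 0) :
    H1 z ζ = ((1 - normSq ζ : ℝ) * ((((1/2) * (3 - normSq ζ) : ℝ) : ℂ) *
      ((1 + z * conj ζ) / (1 - z * conj ζ)) + ((1 - normSq ζ : ℝ) : ℂ) *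
        (z * conj ζ / (1 - z * conj ζ) ^ 2))).re := by
  have h1 : ((1 + z * conj ζ) / (1 - z * conj ζ)).re
      = (1 - normSq (z * ζ)) / normSq (1 - z * conj ζ) := by
    have e : normSq (z * ζ) = normSq (z * conj ζ) := by simp
    rw [e, div_re]
    rw [← normSq_eq_denSq] at h
    field_simp
    simp [normSq_apply]; ring
  rw [H1, re_ofReal_mul, add_re, re_ofReal_mul, re_ofReal_mul, h1]
  ring

lemma one_sub_mul_conj_ne_zero {z ζ : ℂ} (h : denSq ζ z ≠ 0) : 1 - z * conj ζ ≠ 0 := by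
  rwa [← normSq_eq_denSq, Ne, normSq_eq_zero] at h

lemma analyticAt_H1_aux {z ζ : ℂ} (h : denSq ζ z ≠ 0) :
    AnalyticAt ℂ (fun z : ℂ => ((1 - normSq ζ : ℝ) : ℂ) * ((((1/2) * (3 - normSq ζ) : ℝ) : ℂ) *
      ((1 + z * conj ζ) / (1 - z * conj ζ)) + ((1 - normSq ζ : ℝ) : ℂ) *
        (z * conj ζ / (1 - z * conj ζ) ^ 2))) z := by
  have h0 := one_sub_mul_conj_ne_zero h
  fun_prop (disch := first | exact h0 | exact pow_ne_zero 2 h0)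

lemma lap_H1 {z ζ : ℂ} (h : denSq ζ z ≠ 0) : lap (fun w => H1 w ζ) z = 0 := by
  rw [lap_congr ((eventually_denSq_ne_zero h).mono fun w hw => H1_eq_re hw)]
  exact lap_re_of_analyticAt (analyticAt_H1_aux h)

lemma contDiffAt_H1 {z ζ : ℂ} (h : denSq ζ z ≠ 0) : ContDiffAt ℝ 2 (fun w => H1 w ζ) z := by
  have h1 := ((analyticAt_H1_aux h).contDiffAt (n := 2)).restrict_scalars ℝ
  exact (reCLM.contDiff.contDiffAt.comp z h1).congr_of_eventuallyEq
    ((eventually_denSq_ne_zero h).mono fun w hw => H1_eq_re hw)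

/-- The factor `1 - |z + ζ|²/4`, so that `Γ₁ = |z - ζ|² (1 - |z + ζ|²/4) G + …`. -/
def greenFactor (ζ z : ℂ) : ℝ := 1 - 1 / 4 * ((z.re + ζ.re) ^ 2 + (z.im + ζ.im) ^ 2)

/-- The part of `Γ₁` without logarithms. -/
def greenRest (ζ z : ℂ) : ℝ :=
  1 / 8 * (1 - (ζ.re ^ 2 + ζ.im ^ 2)) * ((1 - (z.re ^ 2 + z.im ^ 2)) *
    (7 - (ζ.re ^ 2 + ζ.im ^ 2) - (1 + (ζ.re ^ 2 + ζ.im ^ 2)) * (z.re ^ 2 + z.im ^ 2)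
      - 4 * (z.re * ζ.re + z.im * ζ.im))
    - 2 * (1 - (ζ.re ^ 2 + ζ.im ^ 2)) * ((1 - (z.re ^ 2 + z.im ^ 2)) ^ 2 *
      (1 - (ζ.re ^ 2 + ζ.im ^ 2) * (z.re ^ 2 + z.im ^ 2)) * (denSq ζ z)⁻¹))

lemma greenG_eq {z ζ : ℂ} (hz : z ≠ ζ) (h : denSq ζ z ≠ 0) :
    greenG z ζ = Real.log (distSq ζ z) - Real.log (denSq ζ z) := by
  rw [greenG, normSq_div, mul_comm (conj ζ) z, normSq_eq_denSq, normSq_sub_eq_distSq,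
    Real.log_div (distSq_ne_zero hz) h]

lemma Γ1_eq {z ζ : ℂ} (h : denSq ζ z ≠ 0) :
    Γ1 z ζ = greenFactor ζ z * (distSq ζ z * Real.log (distSq ζ z))
      - greenFactor ζ z * distSq ζ z * Real.log (denSq ζ z) + greenRest ζ z := by
  have hA : normSq (z - ζ) - (1/4) * normSq (z ^ 2 - ζ ^ 2) = greenFactor ζ z * distSq ζ z := by
    simp [greenFactor, distSq, normSq_apply, sq]; ring
  have hB : (1/8) * (1 - normSq z) * (1 - normSq ζ) *
      (7 - normSq z - normSq ζ - normSq (z * ζ) - 4 * (z * conj ζ).re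
        - 2 * (1 - normSq z) * (1 - normSq ζ) * (1 - normSq (z * ζ)) / normSq (1 - z * conj ζ))
      = greenRest ζ z := by
    rw [normSq_eq_denSq, greenRest]
    simp only [normSq_apply, mul_re, mul_im, conj_re, conj_im]
    field_simp
    ring
  rw [Γ1, hA, hB]
  by_cases hz : z = ζ
  · subst hz
    simp [distSq]
  · rw [greenG_eq hz h]; ring

lemma lap_inv_denSq {ζ z : ℂ} (h : denSq ζ z ≠ 0) :
    lap (fun w => (denSq ζ w)⁻¹) z = (ζ.re ^ 2 + ζ.im ^ 2) / denSq ζ z ^ 2 := by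
  have hi := ((hasGrad_denSq ζ z).pow_two).inv (pow_ne_zero 2 h)
  have gx := ((HasGrad.const (2 * ζ.re) z).sub (((HasGrad.re z).const_mul 2).mul
      (HasGrad.const (ζ.re ^ 2 + ζ.im ^ 2) z))).mul hi
  have gy := ((HasGrad.const (2 * ζ.im) z).sub (((HasGrad.im z).const_mul 2).mul
      (HasGrad.const (ζ.re ^ 2 + ζ.im ^ 2) z))).mul hi
  rw [lap_eq_of_hasGrad ((eventually_denSq_ne_zero h).mono fun w hw =>
    ((hasGrad_denSq ζ w).inv hw).congr_grad ?_ ?_) gx gy]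
  · field_simp
    rw [denSq]; ring
  · rw [div_eq_mul_inv]; ring
  · rw [div_eq_mul_inv]; ring

lemma contDiff_greenFactor (ζ : ℂ) : ContDiff ℝ ⊤ (greenFactor ζ) := by
  have h1 : ContDiff ℝ ⊤ Complex.re := reCLM.contDiff
  have h2 : ContDiff ℝ ⊤ Complex.im := imCLM.contDiff
  unfold greenFactor; fun_prop

lemma hasGrad_greenFactor (ζ z : ℂ) :
    HasGrad (greenFactor ζ) (-(1 / 2) * (z.re + ζ.re)) (-(1 / 2) * (z.im + ζ.im)) z := by
  refine ((HasGrad.const 1 z).sub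
    ((((HasGrad.re z).add (HasGrad.const ζ.re z)).pow_two.add
    ((HasGrad.im z).add (HasGrad.const ζ.im z)).pow_two).const_mul (1 / 4))).congr_grad ?_ ?_ <;>
    ring

lemma contDiffAt_greenRest {ζ z : ℂ} (h : denSq ζ z ≠ 0) {n : WithTop ℕ∞} :
    ContDiffAt ℝ n (greenRest ζ) z := by
  have h1 : ContDiff ℝ n Complex.re := reCLM.contDiff
  have h2 : ContDiff ℝ n Complex.im := imCLM.contDiff
  have h3 : ContDiffAt ℝ n (fun z => (denSq ζ z)⁻¹) z :=
    ((contDiff_denSq ζ).of_le le_top).contDiffAt.inv h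
  have e1 : ContDiffAt ℝ n (fun z : ℂ => 1 / 8 * (1 - (ζ.re ^ 2 + ζ.im ^ 2)) *
    ((1 - (z.re ^ 2 + z.im ^ 2)) *
    (7 - (ζ.re ^ 2 + ζ.im ^ 2) - (1 + (ζ.re ^ 2 + ζ.im ^ 2)) * (z.re ^ 2 + z.im ^ 2)
      - 4 * (z.re * ζ.re + z.im * ζ.im)))) z := ContDiff.contDiffAt (by fun_prop)
  have e2 : ContDiffAt ℝ n (fun z : ℂ => 1 / 8 * (1 - (ζ.re ^ 2 + ζ.im ^ 2)) *
    (2 * (1 - (ζ.re ^ 2 + ζ.im ^ 2)) * ((1 - (z.re ^ 2 + z.im ^ 2)) ^ 2 *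
      (1 - (ζ.re ^ 2 + ζ.im ^ 2) * (z.re ^ 2 + z.im ^ 2))))) z := ContDiff.contDiffAt (by fun_prop)
  refine (e1.sub (e2.mul h3)).congr_of_eventuallyEq (Filter.Eventually.of_forall fun w => ?_)
  simp only [greenRest]; ring

lemma lap_greenFactor_mul_distSq (ζ z : ℂ) :
    lap (fun w => greenFactor ζ w * distSq ζ w) z = 1 - (z.re ^ 2 + z.im ^ 2) := by
  have hx := (HasGrad.re z).add (HasGrad.const ζ.re z)
  have hy := (HasGrad.im z).add (HasGrad.const ζ.im z)
  have hx' := (HasGrad.re z).sub (HasGrad.const ζ.re z)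
  have hy' := (HasGrad.im z).sub (HasGrad.const ζ.im z)
  rw [lap_eq_of_hasGrad (Filter.Eventually.of_forall fun w =>
      (hasGrad_greenFactor ζ w).mul (hasGrad_distSq ζ w))
    (((hx.const_mul (-(1 / 2))).mul (hasGrad_distSq ζ z)).add
      ((hasGrad_greenFactor ζ z).mul (hx'.const_mul 2)))
    (((hy.const_mul (-(1 / 2))).mul (hasGrad_distSq ζ z)).add
      ((hasGrad_greenFactor ζ z).mul (hy'.const_mul 2)))]
  simp only [greenFactor, distSq]
  ring

/-- `f` is twice continuously differentiable at `z`, with gradient `(p, q)` and Laplacian `l`. -/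
structure HasJet (f : ℂ → ℝ) (p q l : ℝ) (z : ℂ) : Prop where
  contDiffAt : ContDiffAt ℝ 2 f z
  hasGrad : HasGrad f p q z
  lap_eq : lap f z = l

namespace HasJet

variable {f g : ℂ → ℝ} {p q l p' q' l' : ℝ} {z : ℂ}

lemma const (c : ℝ) (z : ℂ) : HasJet (fun _ => c) 0 0 0 z :=
  ⟨contDiffAt_const, .const c z, lap_const c z⟩

lemma add (hf : HasJet f p q l z) (hg : HasJet g p' q' l' z) :
    HasJet (fun w => f w + g w) (p + p') (q + q') (l + l') z :=
  ⟨hf.1.add hg.1, hf.2.add hg.2, by rw [lap_add hf.1 hg.1, hf.3, hg.3]⟩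

lemma sub (hf : HasJet f p q l z) (hg : HasJet g p' q' l' z) :
    HasJet (fun w => f w - g w) (p - p') (q - q') (l - l') z :=
  ⟨hf.1.sub hg.1, hf.2.sub hg.2, by rw [lap_sub hf.1 hg.1, hf.3, hg.3]⟩

lemma mul (hf : HasJet f p q l z) (hg : HasJet g p' q' l' z) :
    HasJet (fun w => f w * g w) (p * g z + f z * p') (q * g z + f z * q')
      (f z * l' + g z * l + 1 / 2 * (p * p' + q * q')) z :=
  ⟨hf.1.mul hg.1, hf.2.mul hg.2, by
    rw [lap_mul hf.1 hg.1, hf.3, hg.3, hf.2.fderiv_one, hf.2.fderiv_I, hg.2.fderiv_one,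
      hg.2.fderiv_I]⟩

lemma const_mul (c : ℝ) (hf : HasJet f p q l z) :
    HasJet (fun w => c * f w) (c * p) (c * q) (c * l) z :=
  ⟨contDiffAt_const.mul hf.1, hf.2.const_mul c, by rw [lap_const_mul c hf.1, hf.3]⟩

lemma re (z : ℂ) : HasJet Complex.re 1 0 0 z :=
  ⟨reCLM.contDiff.contDiffAt, .re z, by
    rw [lap_eq_of_hasGrad (Filter.Eventually.of_forall fun w => HasGrad.re w) (.const 1 z)
      (.const 0 z)]
    simp⟩

lemma im (z : ℂ) : HasJet Complex.im 0 1 0 z :=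
  ⟨imCLM.contDiff.contDiffAt, .im z, by
    rw [lap_eq_of_hasGrad (Filter.Eventually.of_forall fun w => HasGrad.im w) (.const 0 z)
      (.const 1 z)]
    simp⟩

lemma re_sq_add_im_sq (z : ℂ) :
    HasJet (fun w => w.re ^ 2 + w.im ^ 2) (2 * z.re) (2 * z.im) 1 z := by
  have h := ((re z).mul (re z)).add ((im z).mul (im z))
  simp only [← sq] at h
  convert h using 1 <;> ring

lemma inv_denSq {ζ : ℂ} (h : denSq ζ z ≠ 0) : HasJet (fun w => (denSq ζ w)⁻¹)
    (-(-2 * ζ.re + 2 * z.re * (ζ.re ^ 2 + ζ.im ^ 2)) / denSq ζ z ^ 2)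
    (-(-2 * ζ.im + 2 * z.im * (ζ.re ^ 2 + ζ.im ^ 2)) / denSq ζ z ^ 2)
    ((ζ.re ^ 2 + ζ.im ^ 2) / denSq ζ z ^ 2) z :=
  ⟨((contDiff_denSq ζ).of_le le_top).contDiffAt.inv h, (hasGrad_denSq ζ z).inv h,
    lap_inv_denSq h⟩

end HasJet

lemma H1_eq (ζ z : ℂ) :
    H1 z ζ = (1 - (ζ.re ^ 2 + ζ.im ^ 2)) * (1 / 2 * (3 - (ζ.re ^ 2 + ζ.im ^ 2)) *
      (1 - (z.re ^ 2 + z.im ^ 2) * (ζ.re ^ 2 + ζ.im ^ 2)) / denSq ζ z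
      + (1 - (ζ.re ^ 2 + ζ.im ^ 2)) *
        ((z.re * ζ.re + z.im * ζ.im) * (1 + (z.re ^ 2 + z.im ^ 2) * (ζ.re ^ 2 + ζ.im ^ 2))
        - 2 * ((z.re ^ 2 + z.im ^ 2) * (ζ.re ^ 2 + ζ.im ^ 2))) / denSq ζ z ^ 2) := by
  have e : (z * conj ζ / (1 - z * conj ζ) ^ 2).re =
      ((z.re * ζ.re + z.im * ζ.im) * (1 + (z.re ^ 2 + z.im ^ 2) * (ζ.re ^ 2 + ζ.im ^ 2))
        - 2 * ((z.re ^ 2 + z.im ^ 2) * (ζ.re ^ 2 + ζ.im ^ 2))) / denSq ζ z ^ 2 := by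
    rw [div_re, map_pow, normSq_eq_denSq, ← add_div]
    congr 1
    simp [sq]
    ring
  rw [H1, e, normSq_eq_denSq, normSq_mul, normSq_apply, normSq_apply]
  ring

lemma lap_greenRest {ζ z : ℂ} (hz : z ≠ ζ) (h : denSq ζ z ≠ 0) :
    lap (greenRest ζ) z = (1 - (z.re ^ 2 + z.im ^ 2)) * H1 z ζ
      - 1 / 2 * ((-(1 / 2) * (z.re + ζ.re) * distSq ζ z + greenFactor ζ z * (2 * (z.re - ζ.re))) *
        (2 * (z.re - ζ.re) / distSq ζ z
          - (-2 * ζ.re + 2 * z.re * (ζ.re ^ 2 + ζ.im ^ 2)) / denSq ζ z) +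
        (-(1 / 2) * (z.im + ζ.im) * distSq ζ z + greenFactor ζ z * (2 * (z.im - ζ.im))) *
        (2 * (z.im - ζ.im) / distSq ζ z
          - (-2 * ζ.im + 2 * z.im * (ζ.re ^ 2 + ζ.im ^ 2)) / denSq ζ z)) := by
  have hN := distSq_ne_zero hz
  have jp := HasJet.re_sq_add_im_sq z
  have jq := (HasJet.const 1 z).sub jp
  have jt := ((HasJet.const (7 - (ζ.re ^ 2 + ζ.im ^ 2)) z).sub
    (jp.const_mul (1 + (ζ.re ^ 2 + ζ.im ^ 2)))).sub ((((HasJet.re z).mul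
      (HasJet.const ζ.re z)).add ((HasJet.im z).mul (HasJet.const ζ.im z))).const_mul 4)
  have js := (HasJet.const 1 z).sub (jp.const_mul (ζ.re ^ 2 + ζ.im ^ 2))
  have jr := ((jq.mul jt).sub ((((jq.mul jq).mul js).mul (HasJet.inv_denSq h)).const_mul
    (2 * (1 - (ζ.re ^ 2 + ζ.im ^ 2))))).const_mul (1 / 8 * (1 - (ζ.re ^ 2 + ζ.im ^ 2)))
  refine (lap_congr (Filter.Eventually.of_forall fun w => ?_)).trans (jr.lap_eq.trans ?_)
  · rw [greenRest, sq (1 - _)]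
  rw [H1_eq]
  field_simp
  rw [denSq, distSq, greenFactor]
  ring

lemma lap_Γ1 {ζ z : ℂ} (hz : z ≠ ζ) (h : denSq ζ z ≠ 0) :
    lap (fun w => Γ1 w ζ) z = (1 - normSq z) *
      (Real.log (distSq ζ z) - Real.log (denSq ζ z) + H1 z ζ) := by
  have hN := distSq_ne_zero hz
  have cN : ContDiffAt ℝ 2 (fun w => Real.log (distSq ζ w)) z :=
    ((contDiff_distSq ζ).of_le le_top).contDiffAt.log hN
  have cE : ContDiffAt ℝ 2 (fun w => Real.log (denSq ζ w)) z :=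
    ((contDiff_denSq ζ).of_le le_top).contDiffAt.log h
  have cG := cN.sub cE
  have cA : ContDiffAt ℝ 2 (fun w => greenFactor ζ w * distSq ζ w) z :=
    (((contDiff_greenFactor ζ).mul (contDiff_distSq ζ)).of_le le_top).contDiffAt
  have e : (fun w => Γ1 w ζ) =ᶠ[nhds z] fun w => greenFactor ζ w * distSq ζ w *
      (Real.log (distSq ζ w) - Real.log (denSq ζ w)) + greenRest ζ w := by
    filter_upwards [eventually_denSq_ne_zero h] with w hw
    rw [Γ1_eq hw]; ring
  have gA := (hasGrad_greenFactor ζ z).mul (hasGrad_distSq ζ z)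
  have gG := (hasGrad_log_distSq hz).sub ((hasGrad_denSq ζ z).log h)
  rw [lap_congr e, lap_add (cA.mul cG) (contDiffAt_greenRest h), lap_mul cA cG, lap_sub cN cE,
    lap_log_distSq hz, lap_log_denSq h, lap_greenFactor_mul_distSq, lap_greenRest hz h,
    gA.fderiv_one, gA.fderiv_I, gG.fderiv_one, gG.fderiv_I, normSq_apply]
  ring

/-- The third-order Taylor remainder of the logarithm is `s ^ 3` times an analytic function. -/
lemma exists_log_one_sub_eq : ∃ F : ℝ → ℝ, (∀ s < 1, AnalyticAt ℝ F s) ∧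
    ∀ s < 1, Real.log (1 - s) = -s - s ^ 2 / 2 - s ^ 3 * F s := by
  set f : ℝ → ℝ := fun s => -Real.log (1 - s) - s - s ^ 2 / 2 with hf
  have fan : ∀ s < 1, AnalyticAt ℝ f s := fun s hs => by
    have : 1 - s ≠ 0 := by linarith
    have h1 : AnalyticAt ℝ (fun s : ℝ => Real.log (1 - s)) s :=
      AnalyticAt.log (by fun_prop) (by linarith)
    fun_prop
  have fd : ∀ᶠ s in nhds 0, deriv f s = (s - 0) ^ 2 • (1 - s)⁻¹ := by
    filter_upwards [gt_mem_nhds (zero_lt_one' ℝ)] with s hs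
    have hs' : 1 - s ≠ 0 := by linarith
    have h := (((((hasDerivAt_id s).const_sub 1).log hs').neg).sub (hasDerivAt_id s)).sub
      (((hasDerivAt_id s).pow 2).div_const 2)
    refine (HasDerivAt.deriv (f := f) h).trans ?_
    simp
    field_simp
    ring
  have fo : ((3 : ℕ) : ℕ∞) ≤ analyticOrderAt f 0 := by
    have h2 : ((2 : ℕ) : ℕ∞) ≤ analyticOrderAt (deriv f) 0 :=
      (natCast_le_analyticOrderAt (fan 0 one_pos).deriv).2
        ⟨fun s => (1 - s)⁻¹, by fun_prop (disch := norm_num), fd⟩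
    have h3 := (fan 0 one_pos).analyticOrderAt_deriv_add_one
    have h0 : f 0 = 0 := by simp [hf]
    simp only [h0, sub_zero] at h3
    change _ = analyticOrderAt f 0 at h3
    rw [← h3]
    exact_mod_cast add_le_add_left h2 1
  obtain ⟨g, hg, hfg⟩ := (natCast_le_analyticOrderAt (fan 0 one_pos)).1 fo
  refine ⟨Function.update (fun s => f s / s ^ 3) 0 (g 0), fun s hs => ?_, fun s hs => ?_⟩
  · rcases eq_or_ne s 0 with rfl | h0
    · refine hg.congr (hfg.mono fun s hs => ?_)
      rcases eq_or_ne s 0 with rfl | h0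
      · simp
      · rw [Function.update_of_ne h0, hs, sub_zero, smul_eq_mul]
        field_simp
    · have : AnalyticAt ℝ (fun s => f s / s ^ 3) s :=
        (fan s hs).div (by fun_prop) (pow_ne_zero 3 h0)
      exact this.congr ((eventually_ne_nhds h0).mono fun t ht =>
        by rw [Function.update_of_ne ht])
  · rcases eq_or_ne s 0 with rfl | h0
    · simp
    · rw [Function.update_of_ne h0, hf]
      field_simp
      ring

/-- `Γ₁(·,ζ)` vanishes to third order on the unit circle. -/
lemma exists_Γ1_eq_pow_mul {ζ : ℂ} (hζ : ζ ∈ ball (0:ℂ) 1) : ∃ M : ℂ → ℝ,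
    (∀ z ∈ closedBall (0:ℂ) 1, z ≠ ζ → ContDiffAt ℝ 2 M z) ∧
    ∀ z ∈ closedBall (0:ℂ) 1, z ≠ ζ → Γ1 z ζ = (1 - (z.re ^ 2 + z.im ^ 2)) ^ 3 * M z := by
  obtain ⟨F, hF, hlog⟩ := exists_log_one_sub_eq
  have key : ∀ z : ℂ, denSq ζ z = distSq ζ z +
      (1 - (z.re ^ 2 + z.im ^ 2)) * (1 - (ζ.re ^ 2 + ζ.im ^ 2)) := fun z => by
    rw [denSq, distSq]; ring
  have lt : ∀ z ∈ closedBall (0:ℂ) 1, z ≠ ζ →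
      (1 - (z.re ^ 2 + z.im ^ 2)) * (1 - (ζ.re ^ 2 + ζ.im ^ 2)) / denSq ζ z < 1 := by
    intro z hz hne
    rw [div_lt_one (denSq_pos hζ hz), key z]
    have : 0 < distSq ζ z := lt_of_le_of_ne (by rw [distSq]; positivity) (distSq_ne_zero hne).symm
    linarith
  refine ⟨fun z => (1 - (ζ.re ^ 2 + ζ.im ^ 2)) ^ 3 *
    ((2 * denSq ζ z + 2 * (2 - (z.re ^ 2 + z.im ^ 2) - (ζ.re ^ 2 + ζ.im ^ 2))
      - (1 - (z.re ^ 2 + z.im ^ 2)) * (1 - (ζ.re ^ 2 + ζ.im ^ 2))) / (8 * denSq ζ z ^ 2)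
      - greenFactor ζ z * distSq ζ z *
        F ((1 - (z.re ^ 2 + z.im ^ 2)) * (1 - (ζ.re ^ 2 + ζ.im ^ 2)) / denSq ζ z)
        / denSq ζ z ^ 3), fun z hz hne => ?_, fun z hz hne => ?_⟩
  · have hE := (denSq_pos hζ hz).ne'
    have c1 : ContDiffAt ℝ 2 Complex.re z := reCLM.contDiff.contDiffAt
    have c2 : ContDiffAt ℝ 2 Complex.im z := imCLM.contDiff.contDiffAt
    have c3 : ContDiffAt ℝ 2 (denSq ζ) z := ((contDiff_denSq ζ).of_le le_top).contDiffAt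
    have c4 : ContDiffAt ℝ 2 (distSq ζ) z := ((contDiff_distSq ζ).of_le le_top).contDiffAt
    have c5 : ContDiffAt ℝ 2 (greenFactor ζ) z := ((contDiff_greenFactor ζ).of_le le_top).contDiffAt
    have c6 : ContDiffAt ℝ 2
        (fun z => (1 - (z.re ^ 2 + z.im ^ 2)) * (1 - (ζ.re ^ 2 + ζ.im ^ 2)) / denSq ζ z) z := by
      fun_prop (disch := exact hE)
    have c7 : ContDiffAt ℝ 2 (fun z => F ((1 - (z.re ^ 2 + z.im ^ 2)) *
        (1 - (ζ.re ^ 2 + ζ.im ^ 2)) / denSq ζ z)) z :=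
      (hF _ (lt z hz hne)).contDiffAt.comp z c6
    have c8 : ContDiffAt ℝ 2 (fun z => (2 * denSq ζ z + 2 * (2 - (z.re ^ 2 + z.im ^ 2)
        - (ζ.re ^ 2 + ζ.im ^ 2)) - (1 - (z.re ^ 2 + z.im ^ 2)) * (1 - (ζ.re ^ 2 + ζ.im ^ 2)))
        / (8 * denSq ζ z ^ 2)) z := by
      fun_prop (disch := simpa using hE)
    exact contDiffAt_const.mul (c8.sub (((c5.mul c4).mul c7).div (c3.pow 3) (pow_ne_zero 3 hE)))
  · have hE := (denSq_pos hζ hz).ne'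
    have hN := distSq_ne_zero hne
    have hl := hlog _ (lt z hz hne)
    have e : 1 - (1 - (z.re ^ 2 + z.im ^ 2)) * (1 - (ζ.re ^ 2 + ζ.im ^ 2)) / denSq ζ z
        = distSq ζ z / denSq ζ z := by
      rw [eq_div_iff hE, sub_mul, div_mul_cancel₀ _ hE, key z]; ring
    rw [e, Real.log_div hN hE] at hl
    have hΓ : Γ1 z ζ = greenFactor ζ z * distSq ζ z *
        (Real.log (distSq ζ z) - Real.log (denSq ζ z)) + greenRest ζ z := by
      rw [Γ1_eq hE]; ring
    rw [hΓ, hl, greenRest]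
    beta_reduce
    generalize F _ = t
    have hA : greenFactor ζ z = (2 * (2 - (z.re ^ 2 + z.im ^ 2) - (ζ.re ^ 2 + ζ.im ^ 2))
      + distSq ζ z) / 4 := by rw [greenFactor, distSq]; ring
    have hc : 2 * (z.re * ζ.re + z.im * ζ.im) = z.re ^ 2 + z.im ^ 2 + (ζ.re ^ 2 + ζ.im ^ 2)
      - distSq ζ z := by rw [distSq]; ring
    have hN' : distSq ζ z = denSq ζ z
      - (1 - (z.re ^ 2 + z.im ^ 2)) * (1 - (ζ.re ^ 2 + ζ.im ^ 2)) := by rw [key z]; ring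
    have hc' : 4 * (z.re * ζ.re + z.im * ζ.im) = 2 * (z.re ^ 2 + z.im ^ 2 + (ζ.re ^ 2 + ζ.im ^ 2)
      - distSq ζ z) := by rw [← hc]; ring
    rw [hA, hc', hN']
    generalize denSq ζ z = E at hE
    generalize z.re ^ 2 + z.im ^ 2 = p
    generalize ζ.re ^ 2 + ζ.im ^ 2 = m
    field_simp
    ring

lemma continuousOn_fderivWithin_punctured {P : ℂ → ℝ} {ζ : ℂ}
    (hP : ContDiffOn ℝ 1 P (closedBall 0 1 \ {ζ})) (d : ℂ) :
    ContinuousOn (fun z => fderivWithin ℝ P (closedBall 0 1 \ {ζ}) z d)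
      (closedBall 0 1 \ {ζ}) :=
  (hP.continuousOn_fderivWithin (uniqueDiffOn_closedDisk.inter isOpen_compl_singleton)
    le_rfl).clm_apply continuousOn_const

/-- The divergence of a field that is smooth up to the boundary away from `ζ`, and extends
continuously across `ζ`, is integrable. -/
lemma integrableOn_planeDiv_of_punctured {P Q F : ℂ → ℝ} {ζ : ℂ} (hζ : ζ ∈ ball (0:ℂ) 1)
    (hP : ContDiffOn ℝ 1 P (closedBall 0 1 \ {ζ})) (hQ : ContDiffOn ℝ 1 Q (closedBall 0 1 \ {ζ}))
    (hF : ContinuousOn F (ball 0 1)) (h : ∀ z ∈ ball (0:ℂ) 1, z ≠ ζ → planeDiv P Q z = F z) :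
    IntegrableOn (planeDiv P Q) (ball 0 1) := by
  obtain ⟨ε, hε, hsub⟩ := nhds_basis_closedBall.mem_iff.1 (isOpen_ball.mem_nhds hζ)
  have hne : ∀ᵐ z : ℂ, z ≠ ζ := by simp [ae_iff]
  have h1 : IntegrableOn (planeDiv P Q) (closedBall ζ ε) := by
    refine ((hF.mono hsub).integrableOn_compact (μ := volume)
      (isCompact_closedBall ζ ε)).congr_fun_ae ?_
    filter_upwards [ae_restrict_mem measurableSet_closedBall, ae_restrict_of_ae hne] with z hz hz'
    exact (h z (hsub hz) hz').symm
  have h2 : IntegrableOn (planeDiv P Q) (ball 0 1 \ ball ζ ε) := by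
    have hs : closedBall (0:ℂ) 1 \ ball ζ ε ⊆ closedBall 0 1 \ {ζ} := fun z hz =>
      ⟨hz.1, fun hz' => hz.2 (by rw [mem_singleton_iff.1 hz']; exact mem_ball_self hε)⟩
    have hc : IntegrableOn (fun z => fderivWithin ℝ P (closedBall 0 1 \ {ζ}) z 1
        + fderivWithin ℝ Q (closedBall 0 1 \ {ζ}) z I) (closedBall 0 1 \ ball ζ ε) :=
      (((continuousOn_fderivWithin_punctured hP 1).add
        (continuousOn_fderivWithin_punctured hQ I)).mono hs).integrableOn_compact (μ := volume)
        ((isCompact_closedBall 0 1).diff isOpen_ball)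
    refine (hc.mono_set (sdiff_subset_sdiff_left ball_subset_closedBall)).congr_fun
      (fun z hz => ?_) (measurableSet_ball.diff measurableSet_ball)
    have hn : closedBall (0:ℂ) 1 \ {ζ} ∈ nhds z := by
      refine Filter.inter_mem (closedDisk_mem_nhds hz.1)
        (isOpen_compl_singleton.mem_nhds fun hz' => hz.2 ?_)
      rw [mem_singleton_iff.1 hz']; exact mem_ball_self hε
    simp only [planeDiv, fderivWithin_of_mem_nhds hn]
  refine (h1.union h2).mono_set fun z hz => ?_
  by_cases hz' : z ∈ ball ζ ε
  · exact .inl (ball_subset_closedBall hz')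
  · exact .inr ⟨hz, hz'⟩

/-- The function `h` is `o(1 / |z - ζ|)` at `ζ`. -/
def MildAt (ζ : ℂ) (h : ℂ → ℝ) : Prop :=
  Filter.Tendsto (fun z => ‖z - ζ‖ * h z) (nhdsWithin ζ {ζ}ᶜ) (nhds 0)

namespace MildAt

variable {ζ : ℂ} {h k : ℂ → ℝ}

lemma add (hh : MildAt ζ h) (hk : MildAt ζ k) : MildAt ζ (fun z => h z + k z) := by
  have := Filter.Tendsto.add hh hk
  rw [MildAt]
  simpa only [← mul_add, add_zero] using this

lemma sub (hh : MildAt ζ h) (hk : MildAt ζ k) : MildAt ζ (fun z => h z - k z) := by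
  have := Filter.Tendsto.sub hh hk
  rw [MildAt]
  simpa only [← mul_sub, sub_zero] using this

lemma mul_continuousAt (hh : MildAt ζ h) (hk : ContinuousAt k ζ) :
    MildAt ζ (fun z => h z * k z) := by
  have := Filter.Tendsto.mul hh (hk.tendsto.mono_left nhdsWithin_le_nhds)
  rw [MildAt]
  simpa only [mul_assoc, zero_mul] using this

lemma congr (hh : MildAt ζ h) (e : ∀ᶠ z in nhds ζ, z ≠ ζ → h z = k z) : MildAt ζ k := by
  refine Filter.Tendsto.congr' ?_ hh
  rw [Filter.EventuallyEq, eventually_nhdsWithin_iff]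
  filter_upwards [e] with z hz hz'
  rw [hz hz']

lemma of_continuousAt (hk : ContinuousAt k ζ) : MildAt ζ k := by
  have h0 : ContinuousAt (fun z : ℂ => ‖z - ζ‖) ζ := by fun_prop
  have h1 : MildAt ζ fun _ => 1 := by
    simpa [MildAt] using h0.tendsto.mono_left (nhdsWithin_le_nhds (s := {ζ}ᶜ))
  simpa using h1.mul_continuousAt hk

lemma log_distSq (ζ : ℂ) : MildAt ζ fun z => Real.log (distSq ζ z) := by
  have h : Continuous fun z : ℂ => 2 * (‖z - ζ‖ * Real.log ‖z - ζ‖) :=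
    continuous_const.mul (Real.continuous_mul_log.comp (by fun_prop))
  have h0 := (h.tendsto ζ).mono_left (nhdsWithin_le_nhds (s := {ζ}ᶜ))
  simp only [sub_self, norm_zero, zero_mul, mul_zero] at h0
  refine h0.congr fun z => ?_
  beta_reduce
  rw [distSq_eq_norm, Real.log_pow]
  push_cast
  ring

/-- A first-order singularity times a function vanishing at `ζ`. -/
lemma of_bound {c : ℂ → ℝ} (hc : ContinuousAt c ζ) (h0 : c ζ = 0)
    (hb : ∀ z, |‖z - ζ‖ * h z| ≤ 2) : MildAt ζ (fun z => c z * h z) := by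
  have h1 : Filter.Tendsto (fun z => 2 * |c z|) (nhdsWithin ζ {ζ}ᶜ) (nhds 0) := by
    have : ContinuousAt (fun z => 2 * |c z|) ζ := by fun_prop
    simpa [h0] using this.tendsto.mono_left (nhdsWithin_le_nhds (s := {ζ}ᶜ))
  refine squeeze_zero_norm (fun z => ?_) h1
  rw [Real.norm_eq_abs, mul_left_comm, abs_mul, mul_comm 2]
  exact mul_le_mul_of_nonneg_left (hb z) (abs_nonneg _)

end MildAt

lemma abs_norm_mul_grad_log_le {ζ z : ℂ} {t : ℝ} (ht : |t| ≤ ‖z - ζ‖) :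
    |‖z - ζ‖ * (2 * t / distSq ζ z)| ≤ 2 := by
  rw [distSq_eq_norm]
  rcases (norm_nonneg (z - ζ)).eq_or_lt with h | h
  · simp [← h]
  · rw [show ‖z - ζ‖ * (2 * t / ‖z - ζ‖ ^ 2) = 2 * t / ‖z - ζ‖ by field_simp, abs_div,
      abs_of_pos h, div_le_iff₀ h, abs_mul, abs_two]
    linarith

/-- The field `a ∇v - v ∇a`, with the derivative of `v` taken within the closed unit disk. -/
def greenField (a v : ℂ → ℝ) (d z : ℂ) : ℝ :=
  a z * fderivWithin ℝ v (closedBall (0:ℂ) 1) z d - v z * fderiv ℝ a z d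

lemma contDiffOn_fderivWithin_disk {v : ℂ → ℝ} {m n : WithTop ℕ∞}
    (hv : ContDiffOn ℝ n v (closedBall (0:ℂ) 1)) (hmn : m + 1 ≤ n) (d : ℂ) :
    ContDiffOn ℝ m (fun z => fderivWithin ℝ v (closedBall (0:ℂ) 1) z d) (closedBall (0:ℂ) 1) :=
  (hv.fderivWithin uniqueDiffOn_closedDisk hmn).clm_apply contDiffOn_const

lemma eventually_fderivWithin_closedDisk {z : ℂ} (hz : z ∈ ball (0:ℂ) 1) (v : ℂ → ℝ) :
    ∀ᶠ w in nhds z, fderivWithin ℝ v (closedBall (0:ℂ) 1) w = fderiv ℝ v w := by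
  filter_upwards [isOpen_ball.mem_nhds hz] with w hw
  rw [fderivWithin_of_mem_nhds (closedDisk_mem_nhds hw)]

lemma planeDiv_congr {P Q P' Q' : ℂ → ℝ} {z : ℂ} (hP : P =ᶠ[nhds z] P') (hQ : Q =ᶠ[nhds z] Q') :
    planeDiv P Q z = planeDiv P' Q' z := by
  rw [planeDiv, planeDiv, hP.fderiv_eq, hQ.fderiv_eq]

lemma planeDiv_add {P Q P' Q' : ℂ → ℝ} {z : ℂ} (hP : DifferentiableAt ℝ P z)
    (hQ : DifferentiableAt ℝ Q z) (hP' : DifferentiableAt ℝ P' z)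
    (hQ' : DifferentiableAt ℝ Q' z) :
    planeDiv (fun w => P w + P' w) (fun w => Q w + Q' w) z = planeDiv P Q z + planeDiv P' Q' z := by
  simp only [planeDiv, fderiv_fun_add hP hP', fderiv_fun_add hQ hQ', _root_.add_apply]
  ring

lemma contDiffOn_greenField {a v : ℂ → ℝ} {s : Set ℂ} (hs : s ⊆ closedBall (0:ℂ) 1)
    (ha : ∀ z ∈ s, ContDiffAt ℝ 2 a z) (hv : ContDiffOn ℝ 2 v (closedBall (0:ℂ) 1)) (d : ℂ) :
    ContDiffOn ℝ 1 (greenField a v d) s := by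
  have h2 : (1 : WithTop ℕ∞) + 1 ≤ 2 := by norm_num
  have h1 : (1 : WithTop ℕ∞) ≤ 2 := by norm_num
  have a0 : ContDiffOn ℝ 1 a s := fun z hz => ((ha z hz).of_le h1).contDiffWithinAt
  have a1 : ContDiffOn ℝ 1 (fun z => fderiv ℝ a z d) s := fun z hz =>
    (contDiffAt_fderiv_apply (ha z hz) h2 d).contDiffWithinAt
  exact (a0.mul ((contDiffOn_fderivWithin_disk hv h2 d).mono hs)).sub
    (((hv.of_le h1).mono hs).mul a1)

lemma planeDiv_greenField {a v : ℂ → ℝ} {z : ℂ} (hz : z ∈ ball (0:ℂ) 1) (ha : ContDiffAt ℝ 2 a z)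
    (hv : ContDiffOn ℝ 2 v (closedBall (0:ℂ) 1)) :
    planeDiv (greenField a v 1) (greenField a v I) z = 4 * (a z * lap v z - v z * lap a z) := by
  rw [← planeDiv_green ha (hv.contDiffAt (closedDisk_mem_nhds hz))]
  have h := eventually_fderivWithin_closedDisk hz v
  exact planeDiv_congr (h.mono fun w hw => by simp only [greenField, hw])
    (h.mono fun w hw => by simp only [greenField, hw])

lemma mildAt_greenField {a v : ℂ → ℝ} {ζ : ℂ} (hζ : ζ ∈ ball (0:ℂ) 1) (ha : ContDiffAt ℝ 2 a ζ)
    (hv : ContDiffOn ℝ 2 v (closedBall (0:ℂ) 1)) (d : ℂ) : MildAt ζ (greenField a v d) := by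
  refine .of_continuousAt ?_
  have h := contDiffOn_greenField (s := {ζ}) (singleton_subset_iff.2 (ball_subset_closedBall hζ))
    (fun z hz => by rwa [mem_singleton_iff.1 hz]) hv d
  have h2 : (1 : WithTop ℕ∞) + 1 ≤ 2 := by norm_num
  have n := closedDisk_mem_nhds hζ
  exact (ha.continuousAt.mul ((contDiffOn_fderivWithin_disk hv h2 d).continuousOn.continuousAt
    n)).sub ((hv.continuousOn.continuousAt n).mul
    (contDiffAt_fderiv_apply ha h2 d).continuousAt)

lemma mildAt_greenField_log {v : ℂ → ℝ} {ζ : ℂ} (hζ : ζ ∈ ball (0:ℂ) 1)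
    (hv : ContDiffOn ℝ 2 v (closedBall (0:ℂ) 1)) (h0 : v ζ = 0) {d : ℂ} (hd : d = 1 ∨ d = I) :
    MildAt ζ (greenField (fun z => Real.log (distSq ζ z)) v d) := by
  have h2 : (1 : WithTop ℕ∞) + 1 ≤ 2 := by norm_num
  have n := closedDisk_mem_nhds hζ
  have c0 := hv.continuousOn.continuousAt n
  refine ((MildAt.log_distSq ζ).mul_continuousAt
    ((contDiffOn_fderivWithin_disk hv h2 d).continuousOn.continuousAt n)).sub ?_
  rcases hd with rfl | rfl
  · refine (MildAt.of_bound c0 h0 fun z => abs_norm_mul_grad_log_le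
      (t := z.re - ζ.re) (by simpa using Complex.abs_re_le_norm (z - ζ))).congr
      (Filter.Eventually.of_forall fun z hz => ?_)
    rw [(hasGrad_log_distSq hz).fderiv_one]
  · refine (MildAt.of_bound c0 h0 fun z => abs_norm_mul_grad_log_le
      (t := z.im - ζ.im) (by simpa using Complex.abs_im_le_norm (z - ζ))).congr
      (Filter.Eventually.of_forall fun z hz => ?_)
    rw [(hasGrad_log_distSq hz).fderiv_I]

/-- The continuous extension of the Laplacian to the closed disk. -/
lemma exists_lap_extension {u : ℂ → ℝ} (hu : ContDiffOn ℝ (⊤ : ℕ∞) u (closedBall (0:ℂ) 1)) :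
    ∃ g : ℂ → ℝ, ContDiffOn ℝ 2 g (closedBall (0:ℂ) 1) ∧ ∀ z ∈ ball (0:ℂ) 1, lap u z = g z := by
  have h2 : (2 : WithTop ℕ∞) + 1 ≤ 3 := by norm_num
  have h3 : (3 : WithTop ℕ∞) + 1 ≤ ((⊤ : ℕ∞) : WithTop ℕ∞) := by
    have : ((4 : ℕ∞) : WithTop ℕ∞) ≤ ((⊤ : ℕ∞) : WithTop ℕ∞) := WithTop.coe_le_coe.2 le_top
    norm_num
    exact this
  refine ⟨fun z => 1 / 4 * (fderivWithin ℝ (fun w => fderivWithin ℝ u (closedBall 0 1) w 1)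
    (closedBall 0 1) z 1 + fderivWithin ℝ (fun w => fderivWithin ℝ u (closedBall 0 1) w I)
    (closedBall 0 1) z I), contDiffOn_const.mul
    ((contDiffOn_fderivWithin_disk (contDiffOn_fderivWithin_disk hu h3 1) h2 1).add
    (contDiffOn_fderivWithin_disk (contDiffOn_fderivWithin_disk hu h3 I) h2 I)),
    fun z hz => ?_⟩
  have e : ∀ d : ℂ, (fun w => fderivWithin ℝ u (closedBall 0 1) w d) =ᶠ[nhds z]
      fun w => fderiv ℝ u w d := fun d =>
    (eventually_fderivWithin_closedDisk hz u).mono fun w hw => by simp only [hw]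
  beta_reduce
  rw [lap, fderivWithin_of_mem_nhds (closedDisk_mem_nhds hz),
    fderivWithin_of_mem_nhds (closedDisk_mem_nhds hz), (e 1).fderiv_eq, (e I).fderiv_eq]

/-- The weight `1 - |z|²` in real coordinates. -/
def diskWeight (z : ℂ) : ℝ := 1 - (z.re ^ 2 + z.im ^ 2)

lemma diskWeight_eq (z : ℂ) : diskWeight z = 1 - normSq z := by
  rw [diskWeight, normSq_apply]; ring

lemma diskWeight_pos {z : ℂ} (hz : z ∈ ball (0:ℂ) 1) : 0 < diskWeight z := by
  rw [mem_ball_zero_iff] at hz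
  rw [diskWeight_eq, normSq_eq_norm_sq]
  nlinarith [norm_nonneg z]

lemma diskWeight_of_norm_eq_one {z : ℂ} (hz : ‖z‖ = 1) : diskWeight z = 0 := by
  rw [diskWeight_eq, normSq_eq_norm_sq, hz]; norm_num

lemma contDiff_diskWeight : ContDiff ℝ ⊤ diskWeight := by
  have h1 : ContDiff ℝ ⊤ Complex.re := reCLM.contDiff
  have h2 : ContDiff ℝ ⊤ Complex.im := imCLM.contDiff
  unfold diskWeight; fun_prop

/-- The field `Γ ∇f - f ∇Γ` for `Γ = (1 - |z|²)³ M` and `f = (1 - |z|²)⁻¹ g`, written so that it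
makes sense on the unit circle. -/
def weightedField (M g : ℂ → ℝ) (d z : ℂ) : ℝ :=
  diskWeight z ^ 2 * (M z * fderivWithin ℝ g (closedBall (0:ℂ) 1) z d - g z * fderiv ℝ M z d)
    - 4 * diskWeight z * M z * g z * fderiv ℝ diskWeight z d

lemma weightedField_of_norm_eq_one (M g : ℂ → ℝ) (d : ℂ) {z : ℂ} (hz : ‖z‖ = 1) :
    weightedField M g d z = 0 := by
  simp [weightedField, diskWeight_of_norm_eq_one hz]

lemma contDiffOn_weightedField {M g : ℂ → ℝ} {s : Set ℂ} (hs : s ⊆ closedBall (0:ℂ) 1)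
    (hM : ∀ z ∈ s, ContDiffAt ℝ 2 M z) (hg : ContDiffOn ℝ 2 g (closedBall (0:ℂ) 1)) (d : ℂ) :
    ContDiffOn ℝ 1 (weightedField M g d) s := by
  have h1 : (1 : WithTop ℕ∞) ≤ 2 := by norm_num
  have cw : ContDiffOn ℝ 1 diskWeight s := (contDiff_diskWeight.of_le le_top).contDiffOn
  have cw' : ContDiffOn ℝ 1 (fun z => fderiv ℝ diskWeight z d) s := fun z _ =>
    (contDiffAt_fderiv_apply contDiff_diskWeight.contDiffAt le_top d).contDiffWithinAt
  have cM : ContDiffOn ℝ 1 M s := fun z hz => ((hM z hz).of_le h1).contDiffWithinAt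
  have cg : ContDiffOn ℝ 1 g s := (hg.of_le h1).mono hs
  have cf := contDiffOn_greenField hs hM hg d
  exact ((cw.pow 2).mul cf).sub ((((contDiffOn_const.mul cw).mul cM).mul cg).mul cw')

lemma weightedField_eq {M g Γ f : ℂ → ℝ} {z : ℂ} (hz : z ∈ ball (0:ℂ) 1)
    (hM : ContDiffAt ℝ 2 M z) (hg : ContDiffOn ℝ 2 g (closedBall (0:ℂ) 1))
    (hΓ : Γ =ᶠ[nhds z] fun w => diskWeight w ^ 3 * M w)
    (hf : ∀ w ∈ ball (0:ℂ) 1, f w = (diskWeight w)⁻¹ * g w) (d : ℂ) :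
    weightedField M g d z = Γ z * fderiv ℝ f z d - f z * fderiv ℝ Γ z d := by
  have hw := (diskWeight_pos hz).ne'
  have dw : DifferentiableAt ℝ diskWeight z :=
    contDiff_diskWeight.contDiffAt.differentiableAt (by simp)
  have dM : DifferentiableAt ℝ M z := hM.differentiableAt two_ne_zero
  have dg : DifferentiableAt ℝ g z :=
    (hg.contDiffAt (closedDisk_mem_nhds hz)).differentiableAt two_ne_zero
  have hf' : f =ᶠ[nhds z] fun w => (diskWeight w)⁻¹ * g w := by
    filter_upwards [isOpen_ball.mem_nhds hz] with w hw using hf w hw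
  have hi : fderiv ℝ (fun w => (diskWeight w)⁻¹) z =
      -((diskWeight z ^ 2)⁻¹) • fderiv ℝ diskWeight z :=
    ((hasDerivAt_inv hw).comp_hasFDerivAt z dw.hasFDerivAt).fderiv
  rw [hΓ.fderiv_eq, hf'.fderiv_eq, hΓ.eq_of_nhds, hf z hz,
    fderiv_fun_mul (dw.fun_pow 3) dM, fderiv_fun_mul (dw.fun_inv hw) dg, fderiv_fun_pow 3 dw,
    hi, weightedField, (eventually_fderivWithin_closedDisk hz g).self_of_nhds]
  simp
  field_simp
  ring

lemma planeDiv_weightedField {M g Γ f : ℂ → ℝ} {z : ℂ} (hz : z ∈ ball (0:ℂ) 1)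
    (hM : ContDiffAt ℝ 2 M z) (hg : ContDiffOn ℝ 2 g (closedBall (0:ℂ) 1))
    (hΓ : Γ =ᶠ[nhds z] fun w => diskWeight w ^ 3 * M w)
    (hf : ∀ w ∈ ball (0:ℂ) 1, f w = (diskWeight w)⁻¹ * g w) :
    planeDiv (weightedField M g 1) (weightedField M g I) z
      = 4 * (Γ z * lap f z - f z * lap Γ z) := by
  have hw := (diskWeight_pos hz).ne'
  have cw : ContDiffAt ℝ 2 diskWeight z := (contDiff_diskWeight.of_le le_top).contDiffAt
  have hf' : f =ᶠ[nhds z] fun w => (diskWeight w)⁻¹ * g w := by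
    filter_upwards [isOpen_ball.mem_nhds hz] with w hw using hf w hw
  have cf : ContDiffAt ℝ 2 f z :=
    ((cw.inv hw).mul (hg.contDiffAt (closedDisk_mem_nhds hz))).congr_of_eventuallyEq hf'
  have cΓ : ContDiffAt ℝ 2 Γ z := ((cw.pow 3).mul hM).congr_of_eventuallyEq hΓ
  have e : ∀ d, weightedField M g d =ᶠ[nhds z]
      fun w => Γ w * fderiv ℝ f w d - f w * fderiv ℝ Γ w d := fun d => by
    filter_upwards [isOpen_ball.mem_nhds hz, hM.eventually (by simp), hΓ.eventuallyEq_nhds]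
      with w h1 h2 h3 using weightedField_eq h1 h2 hg h3 hf d
  rw [← planeDiv_green cΓ cf, planeDiv_congr (e 1) (e I)]

lemma continuousAt_Γ1 {z ζ : ℂ} (h : denSq ζ z ≠ 0) : ContinuousAt (fun w => Γ1 w ζ) z := by
  have c1 : ContinuousAt (greenFactor ζ) z := (contDiff_greenFactor ζ).continuous.continuousAt
  have c2 : ContinuousAt (distSq ζ) z := (contDiff_distSq ζ).continuous.continuousAt
  have c3 : ContinuousAt (denSq ζ) z := (contDiff_denSq ζ).continuous.continuousAt
  have c4 : ContinuousAt (greenRest ζ) z := (contDiffAt_greenRest h (n := 1)).continuousAt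
  refine ContinuousAt.congr ?_ ((eventually_denSq_ne_zero h).mono fun w hw => (Γ1_eq hw).symm)
  exact ((c1.mul (Real.continuous_mul_log.continuousAt.comp c2)).sub
    ((c1.mul c2).mul (c3.log h))).add c4

lemma mildAt_fderiv_Γ1 {ζ : ℂ} (h : denSq ζ ζ ≠ 0) {d : ℂ} (hd : d = 1 ∨ d = I) :
    MildAt ζ fun z => fderiv ℝ (fun w => Γ1 w ζ) z d := by
  set A : ℂ → ℝ := fun z => greenFactor ζ z * distSq ζ z
  set S : ℂ → ℝ := fun z => greenRest ζ z - A z * Real.log (denSq ζ z)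
  have cA : ContDiff ℝ 2 A := ((contDiff_greenFactor ζ).mul (contDiff_distSq ζ)).of_le le_top
  have cS : ContDiffAt ℝ 2 S ζ := (contDiffAt_greenRest h).sub
    (cA.contDiffAt.mul (((contDiff_denSq ζ).of_le le_top).contDiffAt.log h))
  have h2 : (1 : WithTop ℕ∞) + 1 ≤ 2 := by norm_num
  have eΓ : ∀ᶠ z in nhds ζ, Γ1 z ζ = A z * Real.log (distSq ζ z) + S z :=
    (eventually_denSq_ne_zero h).mono fun z hz => by simp only [Γ1_eq hz, S, A]; ring
  have hlog : MildAt ζ fun z => A z * fderiv ℝ (fun w => Real.log (distSq ζ w)) z d := by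
    rcases hd with rfl | rfl
    · refine (MildAt.of_bound (cA.continuous.continuousAt) (by simp [A, distSq]) fun z =>
        abs_norm_mul_grad_log_le (t := z.re - ζ.re)
        (by simpa using Complex.abs_re_le_norm (z - ζ))).congr
        (Filter.Eventually.of_forall fun z hz => ?_)
      rw [(hasGrad_log_distSq hz).fderiv_one]
    · refine (MildAt.of_bound (cA.continuous.continuousAt) (by simp [A, distSq]) fun z =>
        abs_norm_mul_grad_log_le (t := z.im - ζ.im)
        (by simpa using Complex.abs_im_le_norm (z - ζ))).congr
        (Filter.Eventually.of_forall fun z hz => ?_)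
      rw [(hasGrad_log_distSq hz).fderiv_I]
  refine ((hlog.add ((MildAt.log_distSq ζ).mul_continuousAt
    (contDiffAt_fderiv_apply cA.contDiffAt h2 d).continuousAt)).add
    (.of_continuousAt (contDiffAt_fderiv_apply cS h2 d).continuousAt)).congr ?_
  filter_upwards [eΓ.eventually_nhds, cS.eventually (by simp)] with z hz hS hne
  have dL : DifferentiableAt ℝ (fun w => Real.log (distSq ζ w)) z :=
    HasFDerivAt.differentiableAt (hasGrad_log_distSq hne)
  have dA : DifferentiableAt ℝ A z := cA.contDiffAt.differentiableAt two_ne_zero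
  have e : (fun w => Γ1 w ζ) =ᶠ[nhds z] fun w => A w * Real.log (distSq ζ w) + S w := hz
  rw [e.fderiv_eq, fderiv_fun_add (dA.fun_mul dL) (hS.differentiableAt two_ne_zero),
    fderiv_fun_mul dA dL]
  simp

/-- The boundary-regular field whose divergence is `4 Γ₁ Δ(1 - |z|²)⁻¹Δu`. -/
def reprField (ζ : ℂ) (u M g : ℂ → ℝ) (d z : ℂ) : ℝ :=
  weightedField M g d z +
    (greenField (fun w => Real.log (distSq ζ w)) (fun w => u w - u ζ) d z
      + greenField (fun w => H1 w ζ - Real.log (denSq ζ w)) u d z)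

lemma contDiffAt_log_distSq {ζ z : ℂ} (h : z ≠ ζ) :
    ContDiffAt ℝ 2 (fun w => Real.log (distSq ζ w)) z :=
  ((contDiff_distSq ζ).of_le le_top).contDiffAt.log (distSq_ne_zero h)

lemma contDiffAt_H1_sub_log {ζ z : ℂ} (h : denSq ζ z ≠ 0) :
    ContDiffAt ℝ 2 (fun w => H1 w ζ - Real.log (denSq ζ w)) z :=
  (contDiffAt_H1 h).sub (((contDiff_denSq ζ).of_le le_top).contDiffAt.log h)

section reprField

variable {ζ : ℂ} {u M g : ℂ → ℝ}

lemma contDiffOn_reprField (hζ : ζ ∈ ball (0:ℂ) 1)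
    (hM : ∀ z ∈ closedBall (0:ℂ) 1, z ≠ ζ → ContDiffAt ℝ 2 M z)
    (hg : ContDiffOn ℝ 2 g (closedBall (0:ℂ) 1)) (hu : ContDiffOn ℝ 2 u (closedBall (0:ℂ) 1))
    (d : ℂ) : ContDiffOn ℝ 1 (reprField ζ u M g d) (closedBall (0:ℂ) 1 \ {ζ}) :=
  (contDiffOn_weightedField sdiff_subset (fun z hz => hM z hz.1 hz.2) hg d).add
    ((contDiffOn_greenField sdiff_subset (fun _ hz => contDiffAt_log_distSq hz.2)
      (hu.sub contDiffOn_const) d).add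
    (contDiffOn_greenField sdiff_subset
      (fun _ hz => contDiffAt_H1_sub_log (denSq_pos hζ hz.1).ne') hu d))

lemma eventually_Γ1_eq
    (hΓ : ∀ z ∈ closedBall (0:ℂ) 1, z ≠ ζ → Γ1 z ζ = diskWeight z ^ 3 * M z)
    {z : ℂ} (hz : z ∈ ball (0:ℂ) 1) (hne : z ≠ ζ) :
    (fun w => Γ1 w ζ) =ᶠ[nhds z] fun w => diskWeight w ^ 3 * M w := by
  filter_upwards [closedDisk_mem_nhds hz, eventually_ne_nhds hne] with w h1 h2 using hΓ w h1 h2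

lemma contDiffAt_of_eq_inv_mul {f : ℂ → ℝ} (hg : ContDiffOn ℝ 2 g (closedBall (0:ℂ) 1))
    (hf : ∀ w ∈ ball (0:ℂ) 1, f w = (diskWeight w)⁻¹ * g w) {z : ℂ} (hz : z ∈ ball (0:ℂ) 1) :
    ContDiffAt ℝ 2 f z := by
  have cw : ContDiffAt ℝ 2 diskWeight z := (contDiff_diskWeight.of_le le_top).contDiffAt
  refine ((cw.inv (diskWeight_pos hz).ne').mul
    (hg.contDiffAt (closedDisk_mem_nhds hz))).congr_of_eventuallyEq ?_
  filter_upwards [isOpen_ball.mem_nhds hz] with w hw using hf w hw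

lemma mildAt_reprField {f : ℂ → ℝ} (hζ : ζ ∈ ball (0:ℂ) 1)
    (hM : ∀ z ∈ closedBall (0:ℂ) 1, z ≠ ζ → ContDiffAt ℝ 2 M z)
    (hΓ : ∀ z ∈ closedBall (0:ℂ) 1, z ≠ ζ → Γ1 z ζ = diskWeight z ^ 3 * M z)
    (hg : ContDiffOn ℝ 2 g (closedBall (0:ℂ) 1)) (hu : ContDiffOn ℝ 2 u (closedBall (0:ℂ) 1))
    (hf : ∀ w ∈ ball (0:ℂ) 1, f w = (diskWeight w)⁻¹ * g w) {d : ℂ} (hd : d = 1 ∨ d = I) :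
    MildAt ζ (reprField ζ u M g d) := by
  have hden : denSq ζ ζ ≠ 0 := (denSq_pos hζ (ball_subset_closedBall hζ)).ne'
  have cf : ContDiffAt ℝ 2 f ζ := contDiffAt_of_eq_inv_mul hg hf hζ
  have hmain : MildAt ζ fun z =>
      Γ1 z ζ * fderiv ℝ f z d - fderiv ℝ (fun w => Γ1 w ζ) z d * f z :=
    (MildAt.of_continuousAt ((continuousAt_Γ1 hden).mul
      (contDiffAt_fderiv_apply cf (m := 1) (by norm_num) d).continuousAt)).sub
      ((mildAt_fderiv_Γ1 hden hd).mul_continuousAt cf.continuousAt)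
  refine (hmain.congr ?_).add ((mildAt_greenField_log hζ (hu.sub contDiffOn_const)
    (sub_self _) hd).add (mildAt_greenField hζ (contDiffAt_H1_sub_log hden) hu d))
  filter_upwards [isOpen_ball.mem_nhds hζ] with z hz hne
  rw [weightedField_eq hz (hM z (ball_subset_closedBall hz) hne) hg (eventually_Γ1_eq hΓ hz hne) hf]
  ring

lemma planeDiv_reprField {f : ℂ → ℝ} (hζ : ζ ∈ ball (0:ℂ) 1)
    (hM : ∀ z ∈ closedBall (0:ℂ) 1, z ≠ ζ → ContDiffAt ℝ 2 M z)
    (hΓ : ∀ z ∈ closedBall (0:ℂ) 1, z ≠ ζ → Γ1 z ζ = diskWeight z ^ 3 * M z)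
    (hg : ContDiffOn ℝ 2 g (closedBall (0:ℂ) 1)) (hu : ContDiffOn ℝ 2 u (closedBall (0:ℂ) 1))
    (hf : ∀ w ∈ ball (0:ℂ) 1, f w = (diskWeight w)⁻¹ * g w)
    (hgu : ∀ w ∈ ball (0:ℂ) 1, lap u w = g w) {z : ℂ} (hz : z ∈ ball (0:ℂ) 1) (hne : z ≠ ζ) :
    planeDiv (reprField ζ u M g 1) (reprField ζ u M g I) z = 4 * (Γ1 z ζ * lap f z) := by
  have hK := closedDisk_mem_nhds hz
  have hz' := ball_subset_closedBall hz
  have hden : denSq ζ z ≠ 0 := (denSq_pos hζ hz').ne'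
  have hw := (diskWeight_pos hz).ne'
  have cL := contDiffAt_log_distSq hne
  have cb := contDiffAt_H1_sub_log hden
  have cu : ContDiffOn ℝ 2 (fun w => u w - u ζ) (closedBall (0:ℂ) 1) := hu.sub contDiffOn_const
  have hs : closedBall (0:ℂ) 1 \ {ζ} ∈ nhds z :=
    Filter.inter_mem hK (isOpen_ne.mem_nhds hne)
  have d1 : ∀ d, DifferentiableAt ℝ (weightedField M g d) z := fun d =>
    ((contDiffOn_weightedField sdiff_subset (fun w hw => hM w hw.1 hw.2) hg d).contDiffAt
      hs).differentiableAt one_ne_zero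
  have d2 : ∀ d, DifferentiableAt ℝ
      (greenField (fun w => Real.log (distSq ζ w)) (fun w => u w - u ζ) d) z := fun d =>
    ((contDiffOn_greenField sdiff_subset (fun w hw => contDiffAt_log_distSq hw.2)
      cu d).contDiffAt hs).differentiableAt one_ne_zero
  have d3 : ∀ d, DifferentiableAt ℝ
      (greenField (fun w => H1 w ζ - Real.log (denSq ζ w)) u d) z := fun d =>
    ((contDiffOn_greenField sdiff_subset (fun w hw => contDiffAt_H1_sub_log
      (denSq_pos hζ hw.1).ne') hu d).contDiffAt hs).differentiableAt one_ne_zero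
  have e : planeDiv (reprField ζ u M g 1) (reprField ζ u M g I) z =
      planeDiv (weightedField M g 1) (weightedField M g I) z +
      (planeDiv (greenField (fun w => Real.log (distSq ζ w)) (fun w => u w - u ζ) 1)
          (greenField (fun w => Real.log (distSq ζ w)) (fun w => u w - u ζ) I) z +
        planeDiv (greenField (fun w => H1 w ζ - Real.log (denSq ζ w)) u 1)
          (greenField (fun w => H1 w ζ - Real.log (denSq ζ w)) u I) z) := by
    rw [← planeDiv_add (d2 1) (d2 I) (d3 1) (d3 I), ← planeDiv_add (d1 1) (d1 I)
      ((d2 1).fun_add (d3 1)) ((d2 I).fun_add (d3 I))]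
    rfl
  rw [e, planeDiv_weightedField hz (hM z hz' hne) hg (eventually_Γ1_eq hΓ hz hne) hf,
    planeDiv_greenField hz cL cu, planeDiv_greenField hz cb hu, lap_log_distSq hne,
    lap_Γ1 hne hden, ← diskWeight_eq, hf z hz,
    lap_sub (hu.contDiffAt hK) contDiffAt_const, lap_const, hgu z hz,
    lap_sub (contDiffAt_H1 hden) (((contDiff_denSq ζ).of_le le_top).contDiffAt.log hden),
    lap_H1 hden, lap_log_denSq hden]
  field_simp
  ring

lemma reprField_normal (hbd : ∀ z ∈ sphere (0:ℂ) 1, u z = 0) (hζ : ζ ∈ ball (0:ℂ) 1)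
    {z : ℂ} (hz : ‖z‖ = 1) :
    reprField ζ u M g 1 z * z.re + reprField ζ u M g I z * z.im =
      -(H1 z ζ * dnD u z) + u ζ * (1 + poissonKernel 0 ζ z) := by
  have hu0 : u z = 0 := hbd z (by simpa using hz)
  have hsq : z.re ^ 2 + z.im ^ 2 = 1 := by
    have := normSq_eq_norm_sq z
    rw [normSq_apply, hz] at this
    linarith
  have hne : z ≠ ζ := by
    rintro rfl
    rw [mem_ball_zero_iff] at hζ
    exact hζ.ne hz
  have hN := distSq_ne_zero hne
  have hND : denSq ζ z = distSq ζ z := by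
    rw [denSq, distSq, hsq]
    linear_combination -hsq
  have hD : dnD u z = -(fderivWithin ℝ u (closedBall 0 1) z 1 * z.re +
      fderivWithin ℝ u (closedBall 0 1) z I * z.im) := by
    have hL : ∀ L : ℂ →L[ℝ] ℝ, L z = L 1 * z.re + L I * z.im := fun L => by
      conv_lhs => rw [show z = z.re • (1:ℂ) + z.im • I by simp [Complex.re_add_im]]
      rw [map_add, map_smul, map_smul, smul_eq_mul, smul_eq_mul]
      ring
    rw [dnD, map_neg, hL]
  have hP : poissonKernel 0 ζ z
      = (1 - (ζ.re ^ 2 + ζ.im ^ 2)) / distSq ζ z := by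
    rw [poissonKernel_def, distSq_eq_norm]
    simp only [sub_zero, hz, ← normSq_eq_norm_sq ζ, normSq_apply]
    ring
  rw [reprField, reprField, weightedField_of_norm_eq_one _ _ _ hz,
    weightedField_of_norm_eq_one _ _ _ hz, hP, hD]
  simp only [greenField, hu0, fderivWithin_sub_const, hND, (hasGrad_log_distSq hne).fderiv_one,
    (hasGrad_log_distSq hne).fderiv_I]
  have hN' : distSq ζ z = 1 - 2 * (z.re * ζ.re + z.im * ζ.im) + (ζ.re ^ 2 + ζ.im ^ 2) := by
    rw [distSq]; linear_combination hsq
  field_simp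
  rw [hN']
  linear_combination (2 * u ζ) * hsq

end reprField

lemma polarMap_one_eq (θ : ℝ) : polarMap (1, θ) = Complex.exp (θ * I) := by
  rw [polarMap, Complex.exp_mul_I]
  push_cast
  ring

lemma integral_poissonKernel {ζ : ℂ} (hζ : ζ ∈ ball (0:ℂ) 1) :
    ∫ θ in (0:ℝ)..(2 * Real.pi), poissonKernel 0 ζ (Complex.exp (θ * I)) = 2 * Real.pi := by
  have h := InnerProductSpace.HarmonicOnNhd.circleAverage_poissonKernel_smul
    (InnerProductSpace.harmonicOnNhd_const (s := closedBall (0:ℂ) 1) (1:ℝ)) hζ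
  rw [Real.circleAverage_def, smul_eq_mul, inv_mul_eq_iff_eq_mul₀ Real.two_pi_pos.ne',
    mul_one] at h
  simpa [circleMap] using h

lemma intervalIntegral_neg_pi_pi (F : ℂ → ℝ) :
    ∫ θ in (-Real.pi)..Real.pi, F (Complex.exp (θ * I)) =
      ∫ θ in (0:ℝ)..(2 * Real.pi), F (Complex.exp (θ * I)) := by
  have hp : Function.Periodic (fun θ : ℝ => F (Complex.exp (θ * I))) (2 * Real.pi) := fun θ => by
    simp only
    push_cast
    rw [add_mul, Complex.exp_add, Complex.exp_two_pi_mul_I, mul_one]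
  have := hp.intervalIntegral_add_eq (-Real.pi) 0
  rwa [show -Real.pi + 2 * Real.pi = Real.pi by ring, zero_add] at this

lemma continuousOn_dnD {u : ℂ → ℝ} (hu : ContDiffOn ℝ 2 u (closedBall (0:ℂ) 1)) :
    ContinuousOn (dnD u) (closedBall (0:ℂ) 1) :=
  (hu.continuousOn_fderivWithin uniqueDiffOn_closedDisk (by norm_num)).clm_apply
    continuousOn_id.neg

lemma continuousOn_lap {f : ℂ → ℝ} {s : Set ℂ} (hf : ∀ z ∈ s, ContDiffAt ℝ 2 f z) :
    ContinuousOn (lap f) s := fun z hz => by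
  have h2 : (1 : WithTop ℕ∞) + 1 ≤ 2 := by norm_num
  have h1 : (0 : WithTop ℕ∞) + 1 ≤ 1 := by norm_num
  have c : ∀ d, ContinuousAt (fun w => fderiv ℝ (fun w => fderiv ℝ f w d) w d) z := fun d =>
    (contDiffAt_fderiv_apply (contDiffAt_fderiv_apply (hf z hz) h2 d) h1 d).continuousAt
  exact (continuousAt_const.mul ((c 1).add (c I))).continuousWithinAt

lemma setIntegral_areaM (F : ℂ → ℝ) (s : Set ℂ) :
    ∫ z in s, F z ∂areaM = Real.pi⁻¹ * ∫ z in s, F z := by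
  rw [areaM, Measure.restrict_smul, integral_smul_measure, ENNReal.toReal_inv,
    ENNReal.toReal_ofReal Real.pi_pos.le, smul_eq_mul]

lemma integral_reprField_boundary {ζ : ℂ} {u : ℂ → ℝ} (M g : ℂ → ℝ) (hζ : ζ ∈ ball (0:ℂ) 1)
    (hu : ContDiffOn ℝ 2 u (closedBall (0:ℂ) 1)) (hbd : ∀ z ∈ sphere (0:ℂ) 1, u z = 0) :
    ∫ θ in (-Real.pi)..Real.pi, (reprField ζ u M g 1 (polarMap (1, θ)) * Real.cos θ
        + reprField ζ u M g I (polarMap (1, θ)) * Real.sin θ) =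
      -(∫ θ in (0:ℝ)..(2 * Real.pi),
        H1 (Complex.exp (θ * I)) ζ * dnD u (Complex.exp (θ * I))) + 4 * Real.pi * u ζ := by
  have hn : ∀ θ : ℝ, ‖Complex.exp (θ * I)‖ = 1 := Complex.norm_exp_ofReal_mul_I
  have hK : ∀ θ : ℝ, Complex.exp (θ * I) ∈ closedBall (0:ℂ) 1 := fun θ => by simp [hn θ]
  have ce : Continuous fun θ : ℝ => Complex.exp (θ * I) := by fun_prop
  have cH : Continuous fun θ : ℝ => H1 (Complex.exp (θ * I)) ζ := continuous_iff_continuousAt.2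
    fun θ => ContinuousAt.comp (g := fun w => H1 w ζ)
      (contDiffAt_H1 (denSq_pos hζ (hK θ)).ne').continuousAt ce.continuousAt
  have cD : Continuous fun θ : ℝ => dnD u (Complex.exp (θ * I)) :=
    (continuousOn_dnD hu).comp_continuous ce hK
  have cP : Continuous fun θ : ℝ => poissonKernel 0 ζ (Complex.exp (θ * I)) := by
    simp only [poissonKernel_def, sub_zero, hn]
    refine continuous_const.div (by fun_prop) fun θ => ?_
    have : Complex.exp (θ * I) ≠ ζ := fun h => by
      rw [mem_ball_zero_iff, ← h, hn] at hζ
      exact hζ.false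
    simpa [sub_eq_zero] using this
  have e : ∀ θ : ℝ, reprField ζ u M g 1 (polarMap (1, θ)) * Real.cos θ
      + reprField ζ u M g I (polarMap (1, θ)) * Real.sin θ =
      -(H1 (Complex.exp (θ * I)) ζ * dnD u (Complex.exp (θ * I)))
        + u ζ * (1 + poissonKernel 0 ζ (Complex.exp (θ * I))) := fun θ => by
    have := reprField_normal (M := M) (g := g) hbd hζ (hn θ)
    rw [Complex.exp_ofReal_mul_I_re, Complex.exp_ofReal_mul_I_im] at this
    rw [polarMap_one_eq, this]
  have i1 : IntervalIntegrable (fun θ : ℝ => -(H1 (Complex.exp (θ * I)) ζ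
      * dnD u (Complex.exp (θ * I)))) volume 0 (2 * Real.pi) :=
    (cH.mul cD).neg.intervalIntegrable _ _
  have i2 : IntervalIntegrable (fun θ : ℝ => u ζ * (1 + poissonKernel 0 ζ (Complex.exp (θ * I))))
      volume 0 (2 * Real.pi) :=
    (continuous_const.mul (continuous_const.add cP)).intervalIntegrable _ _
  simp only [e]
  rw [intervalIntegral_neg_pi_pi fun z => -(H1 z ζ * dnD u z) + u ζ * (1 + poissonKernel 0 ζ z),
    intervalIntegral.integral_add i1 i2,
    intervalIntegral.integral_neg, intervalIntegral.integral_const_mul,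
    intervalIntegral.integral_add (continuous_const.intervalIntegrable _ _)
      (cP.intervalIntegrable _ _), integral_poissonKernel hζ]
  simp
  ring

lemma integral_Γ1_mul_lap {ζ : ℂ} {u f : ℂ → ℝ} (hζ : ζ ∈ ball (0:ℂ) 1)
    (hu : ContDiffOn ℝ (⊤ : ℕ∞) u (closedBall (0:ℂ) 1)) (hbd : ∀ z ∈ sphere (0:ℂ) 1, u z = 0)
    (hf : ∀ w, f w = (1 - normSq w)⁻¹ * lap u w) :
    4 * ∫ z in ball (0:ℂ) 1, Γ1 z ζ * lap f z =
      -(∫ θ in (0:ℝ)..(2 * Real.pi),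
        H1 (Complex.exp (θ * I)) ζ * dnD u (Complex.exp (θ * I))) + 4 * Real.pi * u ζ := by
  obtain ⟨g, hg, hgu⟩ := exists_lap_extension hu
  obtain ⟨M, hM, hΓ⟩ := exists_Γ1_eq_pow_mul hζ
  have hu2 : ContDiffOn ℝ 2 u (closedBall (0:ℂ) 1) :=
    hu.of_le (WithTop.coe_le_coe.2 (le_top : (2 : ℕ∞) ≤ ⊤))
  have hf' : ∀ w ∈ ball (0:ℂ) 1, f w = (diskWeight w)⁻¹ * g w := fun w hw => by
    rw [hf, hgu w hw, diskWeight_eq]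
  have hP := contDiffOn_reprField hζ hM hg hu2
  have hdiv : ∀ z ∈ ball (0:ℂ) 1, z ≠ ζ →
      planeDiv (reprField ζ u M g 1) (reprField ζ u M g I) z = 4 * (Γ1 z ζ * lap f z) :=
    fun z hz hne => planeDiv_reprField hζ hM hΓ hg hu2 hf' hgu hz hne
  have cF : ContinuousOn (fun z => 4 * (Γ1 z ζ * lap f z)) (ball (0:ℂ) 1) :=
    continuousOn_const.mul (ContinuousOn.mul
      (fun z hz => (continuousAt_Γ1
        (denSq_pos hζ (ball_subset_closedBall hz)).ne').continuousWithinAt)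
      (continuousOn_lap fun z hz => contDiffAt_of_eq_inv_mul hg hf' hz))
  rw [← integral_reprField_boundary M g hζ hu2 hbd,
    ← integral_planeDiv_of_punctured hζ (hP 1) (hP I)
      (integrableOn_planeDiv_of_punctured hζ (hP 1) (hP I) cF hdiv)
      (mildAt_reprField hζ hM hΓ hg hu2 hf' (.inl rfl))
      (mildAt_reprField hζ hM hΓ hg hu2 hf' (.inr rfl)), ← integral_const_mul]
  have hne : ∀ᵐ z ∂(volume.restrict (ball (0:ℂ) 1)), z ≠ ζ :=
    ae_restrict_of_ae (by simp [ae_iff])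
  refine integral_congr_ae ?_
  filter_upwards [hne, ae_restrict_mem measurableSet_ball] with z h1 h2 using (hdiv z h2 h1).symm

/-- Representation formula: for `u` smooth on the closed disk vanishing on the circle,
`u(ζ) = ∫_D Γ₁(z,ζ) Δ(1-|z|²)⁻¹Δu(z) dΣ(z) + (1/2)∫_T H₁(z,ζ) ∂ₙu(z) dσ(z)`. -/
theorem statement0 (u : ℂ → ℝ)
    (hu : ContDiffOn ℝ (⊤ : ℕ∞) u (closedBall (0:ℂ) 1))
    (hbd : ∀ z ∈ sphere (0:ℂ) 1, u z = 0) :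
    ∀ ζ ∈ ball (0:ℂ) 1,
      u ζ =
        (∫ z in ball (0:ℂ) 1,
            Γ1 z ζ * lap (fun w => (1 - normSq w)⁻¹ * lap u w) z ∂areaM)
          + (1/2) * ((2 * Real.pi)⁻¹ *
              ∫ θ in (0:ℝ)..(2 * Real.pi),
                H1 (Complex.exp (θ * Complex.I)) ζ * dnD u (Complex.exp (θ * Complex.I))) := by
  intro ζ hζ
  have h := integral_Γ1_mul_lap hζ hu hbd fun _ => rfl
  rw [setIntegral_areaM]
  generalize ∫ z in ball (0:ℂ) 1, Γ1 z ζ * lap (fun w => (1 - normSq w)⁻¹ * lap u w) z = A at *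
  generalize ∫ θ in (0:ℝ)..(2 * Real.pi), H1 (Complex.exp (θ * I)) ζ
    * dnD u (Complex.exp (θ * I)) = B at *
  field_simp
  linear_combination -h
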